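/- arXiv:1410.4585 — 2 statements merged into one kernel-verified Lean document; each statement's English description precedes it below -/
import Mathlib

section
/- Let w > u be positive integers and h = w + u. For every α > 0 and positive integer N, there exist a positive integer n_0 and constants 0 < ε < d < γ < α, where γ = 1/z for an integer z (so that p = w + u/γ = uz + w and q = w/γ = wz are integers), such that the following holds: if G[X,Y] is a balanced bipartite graph on 2n vertices with n ≥ n_0 and δ(G) ≥ (u/h − γ)n, then either G is in the extremal case with parameter α, or G contains an almost (ε, d, p, q, N)-cover. -/
open Finset

attribute [local instance] Classical.propDecidable

namespace BipTiling

variable {α β V : Type*}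

/-- A proper 2-coloring of the graph `H`. -/
def Proper2Coloring (H : SimpleGraph α) (c : α → Bool) : Prop :=
  ∀ ⦃a b : α⦄, H.Adj a b → c a ≠ c b

/-- `H` is bipartite, i.e. it admits a proper 2-coloring. -/
def IsBip (H : SimpleGraph α) : Prop :=
  ∃ c : α → Bool, Proper2Coloring H c

/-- The size of the color class of color `i` under the 2-coloring `c`. -/
noncomputable def colorCard [Fintype α] (c : α → Bool) (i : Bool) : ℕ :=
  (Finset.univ.filter fun v => c v = i).card

/-- `σ(H)`: the smallest size of a color class over all proper 2-colorings of `H`. -/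
noncomputable def sigmaBip [Fintype α] (H : SimpleGraph α) : ℕ :=
  sInf {k | ∃ c : α → Bool, Proper2Coloring H c ∧
    k = min (colorCard c true) (colorCard c false)}

/-- The finset of connected components of `H`. -/
noncomputable def comps [Fintype α] (H : SimpleGraph α) : Finset H.ConnectedComponent :=
  Finset.univ.image H.connectedComponentMk

/-- `c_i`: the number of vertices of the connected component `K`. -/
noncomputable def compCard [Fintype α] (H : SimpleGraph α) (K : H.ConnectedComponent) : ℕ :=
  (Finset.univ.filter fun v => H.connectedComponentMk v = K).card

/-- `d_i = |W_i| - |U_i|`: the (absolute) difference of the sizes of the two color classes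
of the component `K`, computed with respect to a proper 2-coloring `c` of `H`.
(For a proper 2-coloring this is independent of the choice of `c`, since the 2-coloring of a
connected bipartite graph is unique up to swapping the colors.) -/
noncomputable def compDiff [Fintype α] (H : SimpleGraph α) (c : α → Bool)
    (K : H.ConnectedComponent) : ℕ :=
  (((Finset.univ.filter fun v => H.connectedComponentMk v = K ∧ c v = true).card : ℤ) -
    ((Finset.univ.filter fun v => H.connectedComponentMk v = K ∧ c v = false).card : ℤ)).natAbs

/-- `hcf_c(H) = gcd(c_1, …, c_k)`. -/
noncomputable def hcfC [Fintype α] (H : SimpleGraph α) : ℕ :=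
  (comps H).gcd (compCard H)

/-- `hcf_{χ,c}(H) = gcd(d_1, …, d_k)`, with respect to a proper 2-coloring `c`. -/
noncomputable def hcfChiC [Fintype α] (H : SimpleGraph α) (c : α → Bool) : ℕ :=
  (comps H).gcd (compDiff H c)

/-- `x_2 - x_1` for the 2-coloring `c`, where `x_1 ≤ x_2` are the sizes of its color classes. -/
noncomputable def colorDiff [Fintype α] (c : α → Bool) : ℕ :=
  ((colorCard c true : ℤ) - (colorCard c false : ℤ)).natAbs

/-- `hcf_χ(H)`: the gcd of the set `D(H)` of all differences `x_2 - x_1` of color class sizes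
over all proper 2-colorings of `H` (`0` represents `∞`, i.e. `D(H) = {0}`). -/
noncomputable def hcfChi [Fintype α] (H : SimpleGraph α) : ℕ :=
  (Finset.univ.filter fun c : α → Bool => Proper2Coloring H c).gcd colorDiff

/-- `hcf(H) = 1` for a bipartite graph `H`: `hcf_c(H) = 1` and `hcf_χ(H) ≤ 2`
(in particular `hcf_χ(H)` is finite, i.e. nonzero in our encoding). -/
def HcfOne [Fintype α] (H : SimpleGraph α) : Prop :=
  hcfC H = 1 ∧ 0 < hcfChi H ∧ hcfChi H ≤ 2

/-- `f` is a copy of `H` inside `G` (an injective graph homomorphism). -/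
def IsCopy (H : SimpleGraph α) (G : SimpleGraph β) (f : α → β) : Prop :=
  Function.Injective f ∧ ∀ ⦃a b : α⦄, H.Adj a b → G.Adj (f a) (f b)

/-- `s` is an `H`-tiling of `G`: a finite collection of pairwise vertex-disjoint copies of `H`. -/
def IsHTiling (H : SimpleGraph α) (G : SimpleGraph β) (s : Finset (α → β)) : Prop :=
  (∀ f ∈ s, IsCopy H G f) ∧
    ∀ f ∈ s, ∀ g ∈ s, f ≠ g → ∀ a b : α, f a ≠ g b

/-- The set of vertices covered by the tiling `s`. -/
noncomputable def coveredSet [Fintype α] [Fintype β] (s : Finset (α → β)) : Finset β :=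
  s.biUnion fun f => Finset.univ.image f

/-- `G` has a perfect `H`-tiling (`H`-factor). -/
def HasHFactor [Fintype α] [Fintype β] (H : SimpleGraph α) (G : SimpleGraph β) : Prop :=
  ∃ s : Finset (α → β), IsHTiling H G s ∧ coveredSet s = Finset.univ

/-- `G` has an `H`-tiling covering all but at most `t` vertices. -/
def HasHTilingMissingAtMost [Fintype α] [Fintype β] (H : SimpleGraph α) (G : SimpleGraph β)
    (t : ℕ) : Prop :=
  ∃ s : Finset (α → β), IsHTiling H G s ∧ (Finset.univ \ coveredSet s).card ≤ t

/-- `G` is a bipartite graph with partition sets `X` and `Y`, written `G[X,Y]`. -/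
structure BipartiteWith [Fintype V] (G : SimpleGraph V) (X Y : Finset V) : Prop where
  disj : Disjoint X Y
  cover : X ∪ Y = Finset.univ
  cross : ∀ ⦃a b : V⦄, G.Adj a b → (a ∈ X ∧ b ∈ Y) ∨ (a ∈ Y ∧ b ∈ X)

/-- `e(A,B)`: the number of edges of `G` between `A` and `B`. -/
noncomputable def eAB (G : SimpleGraph V) (A B : Finset V) : ℕ :=
  ((A ×ˢ B).filter fun p => G.Adj p.1 p.2).card

/-- The density `d(A,B) = e(A,B)/(|A||B|)`. -/
noncomputable def dens (G : SimpleGraph V) (A B : Finset V) : ℝ :=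
  (eAB G A B : ℝ) / ((A.card : ℝ) * (B.card : ℝ))

/-- `|Γ(x) ∩ B|`: the number of neighbors of `x` in `B`. -/
noncomputable def degIn (G : SimpleGraph V) (x : V) (B : Finset V) : ℕ :=
  (B.filter fun y => G.Adj x y).card

/-- The pair `(X,Y)` is `ε`-regular in `G`. -/
def EpsRegularPair (G : SimpleGraph V) (X Y : Finset V) (ε : ℝ) : Prop :=
  ∀ A ⊆ X, ∀ B ⊆ Y, ε * X.card < A.card → ε * Y.card < B.card →
    |dens G A B - dens G X Y| < ε

/-- The pair `(X,Y)` is `(ε,δ)`-super-regular in `G`. -/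
def SuperRegularPair (G : SimpleGraph V) (X Y : Finset V) (ε δ : ℝ) : Prop :=
  EpsRegularPair G X Y ε ∧
    (∀ x ∈ X, δ * Y.card < (degIn G x Y : ℝ)) ∧
    (∀ y ∈ Y, δ * X.card < (degIn G y X : ℝ))

/-- `G[X,Y]` has an almost `(ε,d,p,q,N)`-cover. -/
def HasAlmostCover [Fintype V] (G : SimpleGraph V) (X Y : Finset V) (ε d : ℝ) (p q N : ℕ) :
    Prop :=
  ∃ (X₀ Y₀ : Finset V) (k : ℕ) (P Q : Fin k → Finset V),
    X₀ ⊆ X ∧ Y₀ ⊆ Y ∧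
    (X₀.card : ℝ) ≤ ε * X.card ∧ (Y₀.card : ℝ) ≤ ε * Y.card ∧
    ((X₀ ∪ Y₀) ∪ Finset.univ.biUnion fun i => P i ∪ Q i) = Finset.univ ∧
    (∀ i, Disjoint (X₀ ∪ Y₀) (P i ∪ Q i)) ∧
    (∀ i j, i ≠ j → Disjoint (P i ∪ Q i) (P j ∪ Q j)) ∧
    (∀ i, Disjoint (P i) (Q i)) ∧
    (∀ i, SuperRegularPair G (P i) (Q i) ε d) ∧
    (∀ i, (P i ⊆ X ∧ Q i ⊆ Y) ∨ (P i ⊆ Y ∧ Q i ⊆ X)) ∧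
    (∀ i, q * (P i).card = p * (Q i).card ∧ N * p ≤ (P i).card)

/-- `G[X,Y]` (with `|X| = |Y| = n`) is in the extremal case with parameter `a`:
there are `A ⊆ X`, `B ⊆ Y` with `|A| = |B| = ⌊wn/h⌋` and `d(A,B) ≤ a`. -/
def ExtremalWith [Fintype V] (G : SimpleGraph V) (X Y : Finset V) (w h : ℕ) (a : ℝ) : Prop :=
  ∃ A ⊆ X, ∃ B ⊆ Y, A.card = w * X.card / h ∧ B.card = w * X.card / h ∧ dens G A B ≤ a

theorem le_sum_card_filter_inl_eq {A B : Type*} [Fintype A] [Fintype B] {q r : ℕ}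
    (f : A × Fin q ⊕ B × Fin r → B × Fin q ⊕ A × Fin r) (hf : Function.Injective f)
    (hself : ∀ a i a' j, f (Sum.inl (a, i)) = Sum.inr (a', j) → a = a') (a : A) :
    q ≤ (∑ b : B, #{ij : Fin q × Fin q | f (Sum.inl (a, ij.1)) = Sum.inl (b, ij.2)}) + r ∧
      ∑ b : B, #{ij : Fin q × Fin q | f (Sum.inl (a, ij.1)) = Sum.inl (b, ij.2)} ≤ q := by
  have key : ∑ b : B, #{ij : Fin q × Fin q | f (Sum.inl (a, ij.1)) = Sum.inl (b, ij.2)} =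
      #{i : Fin q | (f (Sum.inl (a, i))).isLeft} := by
    rw [← Finset.card_sigma]
    refine Finset.card_bij (fun x _ => x.2.1) ?_ ?_ ?_
    · rintro ⟨b, i, j⟩ h
      simp at h
      simp [h]
    · rintro ⟨b, i, j⟩ h ⟨b', i', j'⟩ h' hi
      simp at h h' hi
      subst hi
      rw [h] at h'
      simp at h'
      obtain ⟨rfl, rfl⟩ := h'
      rfl
    · intro i hi
      simp only [mem_filter, mem_univ, true_and] at hi
      obtain ⟨⟨b, j⟩, hb⟩ := Sum.isLeft_iff.1 hi
      exact ⟨⟨b, i, j⟩, by simp [hb], rfl⟩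
  have hright : #{i : Fin q | ¬ (f (Sum.inl (a, i))).isLeft} ≤ r := by
    have hex : ∀ i : Fin q, ¬ (f (Sum.inl (a, i))).isLeft →
        ∃ j, f (Sum.inl (a, i)) = Sum.inr (a, j) := by
      intro i hi
      rw [Sum.not_isLeft, Sum.isRight_iff] at hi
      obtain ⟨⟨a', j⟩, h⟩ := hi
      obtain rfl := hself _ _ _ _ h
      exact ⟨j, h⟩
    calc _ ≤ #((univ : Finset (Fin r)).image fun j =>
            (Sum.inr (a, j) : B × Fin q ⊕ A × Fin r)) := by
          refine Finset.card_le_card_of_injOn (fun i => f (Sum.inl (a, i))) ?_ ?_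
          · intro i hi
            obtain ⟨j, hj⟩ := hex i (by simpa using hi)
            simp [hj]
          · intro i _ i' _ h
            simpa using hf h
      _ ≤ r := Finset.card_image_le.trans (by simp)
  have htot := Finset.card_filter_add_card_filter_not (s := (univ : Finset (Fin q)))
    (fun i => (f (Sum.inl (a, i))).isLeft = true)
  rw [card_univ, Fintype.card_fin] at htot
  rw [key]
  omega

/-- A bipartite relation that satisfies a Hall-type expansion condition with ratio `p / q` on both
sides carries integer edge weights all of whose weighted degrees lie between `p` and `q`. -/
theorem exists_weights_degree_between {A B : Type*} [Fintype A] [Fintype B] (R : A → B → Prop)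
    {p q : ℕ} (hpq : p ≤ q) (hcard : Fintype.card A = Fintype.card B)
    (hA : ∀ S : Finset A, p * #S ≤ q * #{b | ∃ a ∈ S, R a b})
    (hB : ∀ T : Finset B, p * #T ≤ q * #{a | ∃ b ∈ T, R a b}) :
    ∃ φ : A → B → ℕ, (∀ a b, φ a b ≠ 0 → R a b) ∧
      (∀ a, p ≤ ∑ b, φ a b ∧ ∑ b, φ a b ≤ q) ∧ (∀ b, p ≤ ∑ a, φ a b ∧ ∑ a, φ a b ≤ q) := by
  obtain ⟨r, rfl⟩ := Nat.exists_eq_add_of_le hpq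
  set q := p + r with hq
  let rel : A × Fin q ⊕ B × Fin r → B × Fin q ⊕ A × Fin r → Prop := fun x y =>
    Sum.elim (fun a => Sum.elim (fun b => R a.1 b.1) (fun a' => a.1 = a'.1) y)
      (fun b => Sum.elim (fun b' => b.1 = b'.1) (fun _ => True) y) x
  have hall : ∀ S : Finset (A × Fin q ⊕ B × Fin r), #S ≤ #{y | ∃ x ∈ S, rel x y} := by
    intro S
    set A₁ : Finset A := {a | ∃ i, Sum.inl (a, i) ∈ S} with hA₁
    set B₁ : Finset B := {b | ∃ i, Sum.inr (b, i) ∈ S} with hB₁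
    have hS : #S ≤ q * #A₁ + r * #B₁ := by
      calc #S ≤ #((A₁ ×ˢ (univ : Finset (Fin q))).disjSum (B₁ ×ˢ (univ : Finset (Fin r)))) := by
            apply Finset.card_le_card
            rintro (⟨a, i⟩ | ⟨b, i⟩) hx
            · simpa [hA₁] using ⟨i, hx⟩
            · simpa [hB₁] using ⟨i, hx⟩
        _ = _ := by simp [Finset.card_disjSum, mul_comm]
    rcases B₁.eq_empty_or_nonempty with hB₁e | ⟨b₀, hb₀⟩
    · have h1 : #((({b | ∃ a ∈ A₁, R a b} : Finset B) ×ˢ (univ : Finset (Fin q))).disjSum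
          (A₁ ×ˢ (univ : Finset (Fin r)))) ≤ #{y | ∃ x ∈ S, rel x y} := by
        apply Finset.card_le_card
        rintro (⟨b, i⟩ | ⟨a, i⟩) hx
        · simp [hA₁] at hx
          obtain ⟨a, ⟨j, hj⟩, hR⟩ := hx
          simp only [mem_filter, mem_univ, true_and]
          exact ⟨_, hj, hR⟩
        · simp [hA₁] at hx
          obtain ⟨j, hj⟩ := hx
          simp only [mem_filter, mem_univ, true_and]
          exact ⟨_, hj, rfl⟩
      have h2 := hA A₁
      simp only [Finset.card_disjSum, Finset.card_product, card_univ, Fintype.card_fin] at h1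
      rw [hB₁e] at hS
      simp only [card_empty, mul_zero, add_zero] at hS
      nlinarith
    · set C : Finset B := ({b | ∃ a ∈ A₁, R a b} : Finset B) ∪ B₁ with hC
      have h1 : #((C ×ˢ (univ : Finset (Fin q))).disjSum
          ((univ : Finset A) ×ˢ (univ : Finset (Fin r)))) ≤ #{y | ∃ x ∈ S, rel x y} := by
        apply Finset.card_le_card
        rintro (⟨b, i⟩ | ⟨a, i⟩) hx
        · simp only [mem_filter, mem_univ, true_and]
          simp [hC, hA₁, hB₁] at hx
          rcases hx with ⟨a, ⟨j, hj⟩, hR⟩ | ⟨j, hj⟩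
          · exact ⟨_, hj, hR⟩
          · exact ⟨_, hj, rfl⟩
        · simp only [mem_filter, mem_univ, true_and]
          simp [hB₁] at hb₀
          obtain ⟨j, hj⟩ := hb₀
          exact ⟨_, hj, trivial⟩
      have h2 := hB Cᶜ
      have h3 : #{a | ∃ b ∈ Cᶜ, R a b} + #A₁ ≤ Fintype.card A := by
        rw [← Finset.card_union_of_disjoint]
        · exact Finset.card_le_univ _
        · rw [Finset.disjoint_left]
          intro a ha ha'
          simp only [mem_filter, mem_univ, true_and, hC, mem_compl, mem_union, not_or] at ha
          obtain ⟨b, ⟨hb, -⟩, hR⟩ := ha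
          exact hb ⟨a, ha', hR⟩
      have h4 : #Cᶜ + #C = Fintype.card B := by
        rw [add_comm]; exact Finset.card_add_card_compl C
      have h5 : #B₁ ≤ #C := Finset.card_le_card Finset.subset_union_right
      simp only [Finset.card_disjSum, Finset.card_product, card_univ, Fintype.card_fin] at h1
      have e1 : q * (#{a | ∃ b ∈ Cᶜ, R a b} + #A₁) ≤ q * Fintype.card A := Nat.mul_le_mul_left _ h3
      have e2 : r * #B₁ ≤ r * #C := Nat.mul_le_mul_left _ h5
      have e3 : q * #C = p * #C + r * #C := by rw [hq]; ring
      have e4 : q * Fintype.card A = p * #Cᶜ + p * #C + Fintype.card A * r := by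
        rw [hq, hcard, ← h4]; ring
      have e5 : q * #A₁ + q * #{a | ∃ b ∈ Cᶜ, R a b} =
        q * (#{a | ∃ b ∈ Cᶜ, R a b} + #A₁) := by ring
      linarith [Nat.mul_comm #C q]
  obtain ⟨f, hf, hrel⟩ := (Fintype.all_card_le_filter_rel_iff_exists_injective rel).1 hall
  have hbij : Function.Bijective f := by
    rw [Fintype.bijective_iff_injective_and_card]
    refine ⟨hf, ?_⟩
    simp [hcard]
  let e := Equiv.ofBijective f hbij
  have he : ∀ x, rel x (e x) := hrel
  refine ⟨fun a b => #{ij : Fin q × Fin q | e (Sum.inl (a, ij.1)) = Sum.inl (b, ij.2)},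
    ?_, ?_, ?_⟩
  · intro a b h
    obtain ⟨ij, hij⟩ := Finset.card_ne_zero.1 h
    simp only [mem_filter, mem_univ, true_and] at hij
    have := he (Sum.inl (a, ij.1))
    rw [hij] at this
    exact this
  · intro a
    have := le_sum_card_filter_inl_eq e e.injective (fun a i a' j h => by
      have := he (Sum.inl (a, i))
      rw [h] at this
      exact this) a
    dsimp only
    omega
  · intro b
    have := le_sum_card_filter_inl_eq e.symm e.symm.injective (fun b i b' j h => by
      rw [Equiv.symm_apply_eq] at h
      have := he (Sum.inr (b', j))
      rw [← h] at this
      exact Eq.symm this) b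
    have hsw : ∀ a, #{ij : Fin q × Fin q | e.symm (Sum.inl (b, ij.1)) = Sum.inl (a, ij.2)} =
        #{ij : Fin q × Fin q | e (Sum.inl (a, ij.1)) = Sum.inl (b, ij.2)} := by
      intro a
      refine Finset.card_equiv (Equiv.prodComm _ _) ?_
      rintro ⟨i, j⟩
      simp only [mem_filter, mem_univ, true_and, Equiv.prodComm_apply, Prod.swap_prod_mk,
        Equiv.symm_apply_eq]
      exact eq_comm
    simp only [hsw] at this
    dsimp only
    omega

/-- Under a Hall-type expansion condition with ratio `p / q`, the vertices of a bipartite relation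
can be perfectly covered by related pairs with weights in proportion `p : q` or `q : p`. The weight
received by each vertex depends on `p` and `q` only. -/
theorem exists_perfect_oriented_tiling {A B : Type*} [Fintype A] [Fintype B] (R : A → B → Prop)
    {p q : ℕ} (hp : 0 < p) (hpq : p < q) (hcard : Fintype.card A = Fintype.card B)
    (hA : ∀ S : Finset A, p * #S ≤ q * #{b | ∃ a ∈ S, R a b})
    (hB : ∀ T : Finset B, p * #T ≤ q * #{a | ∃ b ∈ T, R a b}) :
    ∃ c : A → B → Bool → ℕ, (∀ a b o, c a b o ≠ 0 → R a b) ∧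
      (∀ a, ∑ b, ∑ o, (if o then q else p) * c a b o = (q ^ 2 - p ^ 2) * q.factorial ^ 2) ∧
      (∀ b, ∑ a, ∑ o, (if o then p else q) * c a b o = (q ^ 2 - p ^ 2) * q.factorial ^ 2) := by
  obtain ⟨φ, hφ, hφA, hφB⟩ := exists_weights_degree_between R hpq.le hcard hA hB
  have hdiv : ∀ k, p ≤ k ∧ k ≤ q → ∃ g, k * g = q.factorial ∧ p * g ≤ q.factorial ∧
      q.factorial ≤ q * g := by
    rintro k ⟨h1, h2⟩
    obtain ⟨g, hg⟩ := Nat.dvd_factorial (by omega : 0 < k) h2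
    exact ⟨g, hg.symm, hg ▸ Nat.mul_le_mul_right _ h1, hg ▸ Nat.mul_le_mul_right _ h2⟩
  choose gA hgA hgA1 hgA2 using fun a => hdiv _ (hφA a)
  choose gB hgB hgB1 hgB2 using fun b => hdiv _ (hφB b)
  have hsub : ∀ x y : ℕ, p * y ≤ q * x → p * x ≤ q * y →
      q * (q * x - p * y) + p * (q * y - p * x) = (q ^ 2 - p ^ 2) * x := by
    intro x y h1 h2
    have h3 : p ^ 2 ≤ q ^ 2 := Nat.pow_le_pow_left hpq.le 2
    zify [h1, h2, h3]
    ring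
  have hle1 : ∀ a b, p * gB b ≤ q * gA a := fun a b => (hgB1 b).trans (hgA2 a)
  have hle2 : ∀ a b, p * gA a ≤ q * gB b := fun a b => (hgA1 a).trans (hgB2 b)
  refine ⟨fun a b o => φ a b * q.factorial *
    (if o then q * gA a - p * gB b else q * gB b - p * gA a), ?_, ?_, ?_⟩
  · intro a b o h
    refine hφ a b fun h0 => h ?_
    simp [h0]
  · intro a
    have : ∀ b, ∑ o : Bool, (if o then q else p) * (φ a b * q.factorial *
        (if o then q * gA a - p * gB b else q * gB b - p * gA a)) =
        φ a b * (q.factorial * ((q ^ 2 - p ^ 2) * gA a)) := by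
      intro b
      rw [← hsub (gA a) (gB b) (hle1 a b) (hle2 a b)]
      simp
      ring
    simp only [this]
    rw [← Finset.sum_mul, pow_two q.factorial]
    nth_rewrite 3 [← hgA a]
    ring
  · intro b
    have : ∀ a, ∑ o : Bool, (if o then p else q) * (φ a b * q.factorial *
        (if o then q * gA a - p * gB b else q * gB b - p * gA a)) =
        φ a b * (q.factorial * ((q ^ 2 - p ^ 2) * gB b)) := by
      intro a
      rw [← hsub (gB b) (gA a) (hle2 a b) (hle1 a b)]
      simp
      ring
    simp only [this]
    rw [← Finset.sum_mul, pow_two q.factorial]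
    nth_rewrite 3 [← hgB b]
    ring

/-- A bipartite relation whose degrees are almost `(u / h) m` and that has no empty pair on almost
`(w / h) m` vertices on each side satisfies Hall's condition with ratio `(u z + w) / (w z)`. -/
theorem hall_of_degree_of_no_large_empty_pair {A B : Type*} [Fintype A] [Fintype B]
    (R : A → B → Prop) {u w h z m : ℕ} (hu : 0 < u) (hw : 0 < w) (hh : h = u + w)
    (hz : 0 < z) (hpq : u * z + w ≤ w * z)
    (hcA : Fintype.card A = m) (hcB : Fintype.card B = m) {γ : ℝ} (hγ : γ = 1 / (z : ℝ))
    (hdA : ∀ a, ((u : ℝ) / h - 2 * γ) * m ≤ #{b | R a b})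
    (hdB : ∀ b, ((u : ℝ) / h - 2 * γ) * m ≤ #{a | R a b})
    (hne : ∀ (S : Finset A) (T : Finset B), ((w : ℝ) / h - 5 * w * γ) * m ≤ #S →
      ((w : ℝ) / h - 5 * w * γ) * m ≤ #T → ∃ a ∈ S, ∃ b ∈ T, R a b) (S : Finset A) :
    (u * z + w) * #S ≤ (w * z) * #{b | ∃ a ∈ S, R a b} := by
  set N : Finset B := {b | ∃ a ∈ S, R a b} with hN
  rcases S.eq_empty_or_nonempty with rfl | ⟨a₀, ha₀⟩
  · simp
  by_contra! hlt
  have hSm : #S ≤ m := hcA ▸ Finset.card_le_univ S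
  have hNm : #N + #Nᶜ = m := by rw [Finset.card_add_card_compl, hcB]
  have hTne : Nᶜ.Nonempty := by
    rw [← Finset.card_pos]
    by_contra h0
    have : #N = m := by omega
    rw [this] at hlt
    exact absurd hlt (not_lt.2 (Nat.mul_le_mul hpq hSm))
  obtain ⟨b₀, hb₀⟩ := hTne
  have hempty : ∀ a ∈ S, ∀ b ∈ Nᶜ, ¬ R a b := by
    intro a ha b hb hR
    simp only [hN, mem_compl, mem_filter, mem_univ, true_and] at hb
    exact hb ⟨a, ha, hR⟩
  have h1 : ((u : ℝ) / h - 2 * γ) * m ≤ #N := by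
    refine (hdA a₀).trans ?_
    exact_mod_cast Finset.card_le_card fun b hb => by
      simp only [hN, mem_filter, mem_univ, true_and] at hb ⊢
      exact ⟨a₀, ha₀, hb⟩
  have h2 : ((u : ℝ) / h - 2 * γ) * m + #S ≤ m := by
    have : #{a | R a b₀} + #S ≤ m := by
      rw [← Finset.card_union_of_disjoint, ← hcA]
      · exact Finset.card_le_univ _
      · rw [Finset.disjoint_left]
        intro a ha ha'
        simp only [mem_filter, mem_univ, true_and] at ha
        exact hempty a ha' b₀ hb₀ ha
    have h3 : (#{a | R a b₀} : ℝ) + #S ≤ m := by exact_mod_cast this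
    linarith [hdB b₀]
  have hz' : (0 : ℝ) < z := by exact_mod_cast hz
  have hγ0 : 0 < γ := by rw [hγ]; positivity
  have hγ1 : γ ≤ 1 := by
    rw [hγ, div_le_one hz']
    exact_mod_cast hz
  have hzγ : (z : ℝ) * γ = 1 := by rw [hγ]; field_simp
  have hu' : (1 : ℝ) ≤ u := by exact_mod_cast hu
  have hw' : (1 : ℝ) ≤ w := by exact_mod_cast hw
  have hhR : (h : ℝ) = u + w := by rw [hh]; push_cast; ring
  set s : ℝ := (#S : ℝ) with hs
  set t : ℝ := (#N : ℝ) with ht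
  set x : ℝ := (u : ℝ) / h with hx
  set y : ℝ := (w : ℝ) / h with hy
  have hxy : x + y = 1 := by rw [hx, hy, ← add_div, ← hhR]; exact div_self (by linarith)
  have hcross : (w : ℝ) * x = u * y := by rw [hx, hy]; ring
  have hx0 : 0 ≤ x := by positivity
  have hy0 : 0 ≤ y := by positivity
  have hm0 : (0 : ℝ) ≤ m := by positivity
  have hlt' : (w : ℝ) * t < (u + w * γ) * s := by
    have : ((w * z : ℕ) : ℝ) * t < ((u * z + w : ℕ) : ℝ) * s := by
      rw [hs, ht]; exact_mod_cast hlt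
    push_cast at this
    have h4 : ((w : ℝ) * t) * z < ((u + w * γ) * s) * z := by
      calc ((w : ℝ) * t) * z = w * z * t := by ring
        _ < (u * z + w) * s := this
        _ = (u * z + w * (z * γ)) * s := by rw [hzγ]; ring
        _ = _ := by ring
    exact lt_of_mul_lt_mul_right h4 hz'.le
  have hwγ : 0 < (w : ℝ) * γ := by positivity
  have hS : (y - 5 * w * γ) * m ≤ s := by
    by_contra! hc
    have e1 : (u + w * γ) * s ≤ (u + w * γ) * ((y - 5 * w * γ) * m) := by
      apply mul_le_mul_of_nonneg_left hc.le; positivity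
    have e2 : (w : ℝ) * ((x - 2 * γ) * m) ≤ w * t := mul_le_mul_of_nonneg_left h1 (by linarith)
    have e3 : (u + w * γ) * (y - 5 * w * γ) ≤ w * (x - 2 * γ) := by
      have : 0 ≤ w * γ * (5 * u + 5 * w * γ - y - 2) := by
        apply mul_nonneg hwγ.le; linarith
      nlinarith
    have e4 := mul_le_mul_of_nonneg_right e3 hm0
    linarith
  have hT : (y - 5 * w * γ) * m ≤ #Nᶜ := by
    have e0 : t + #Nᶜ = m := by rw [ht]; exact_mod_cast hNm
    have e1 : (u + w * γ) * s ≤ (u + w * γ) * ((y + 2 * γ) * m) := by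
      apply mul_le_mul_of_nonneg_left _ (by positivity)
      have : m - (x - 2 * γ) * m = (y + 2 * γ) * m := by
        rw [← eq_sub_iff_add_eq'] at hxy
        rw [hxy]; ring
      linarith
    have e3 : (u + w * γ) * (y + 2 * γ) ≤ w * (1 - y + 5 * w * γ) := by
      have e5 : 1 - y = x := by linarith
      rw [e5]
      have huw : (u : ℝ) ≤ w := by
        have : u ≤ w := by
          have h5 : u * z ≤ w * z := by omega
          exact Nat.le_of_mul_le_mul_right h5 hz
        exact_mod_cast this
      have : 0 ≤ γ * (w * (5 * w - y - 2 * γ) - 2 * u) := by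
        apply mul_nonneg hγ0.le
        nlinarith
      nlinarith
    have e4 := mul_le_mul_of_nonneg_right e3 hm0
    have e6 : (w : ℝ) * t < w * ((1 - y + 5 * w * γ) * m) := by linarith
    have e7 := lt_of_mul_lt_mul_left e6 (by linarith)
    linarith
  obtain ⟨a, ha, b, hb, hR⟩ := hne S Nᶜ hS hT
  exact hempty a ha b hb hR

theorem exists_disjoint_subsets_card_eq {ι W : Type*} (E : Finset ι) (c : ι → ℕ) (S : Finset W)
    (hc : ∑ e ∈ E, c e ≤ #S) :
    ∃ F : ι → Finset W, (∀ e ∈ E, F e ⊆ S ∧ #(F e) = c e) ∧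
      ∀ e ∈ E, ∀ e' ∈ E, e ≠ e' → Disjoint (F e) (F e') := by
  induction E using Finset.induction_on generalizing S with
  | empty => exact ⟨fun _ => ∅, by simp, by simp⟩
  | insert a E ha ih =>
    rw [Finset.sum_insert ha] at hc
    obtain ⟨T, hTS, hT⟩ := Finset.exists_subset_card_eq (show c a ≤ #S by omega)
    obtain ⟨F, hF, hd⟩ := ih (S \ T) (by rw [Finset.card_sdiff_of_subset hTS]; omega)
    have hne : ∀ e ∈ E, e ≠ a := fun e he h => ha (h ▸ he)
    have hdT : ∀ e ∈ E, Disjoint (F e) T := fun e he =>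
      Finset.disjoint_of_subset_left (hF e he).1 Finset.sdiff_disjoint
    refine ⟨Function.update F a T, ?_, ?_⟩
    · intro e he
      rcases Finset.mem_insert.1 he with rfl | he
      · simpa using ⟨hTS, hT⟩
      · rw [Function.update_of_ne (hne e he)]
        exact ⟨(hF e he).1.trans Finset.sdiff_subset, (hF e he).2⟩
    · intro e he e' he' hee
      rcases Finset.mem_insert.1 he with rfl | h₁ <;> rcases Finset.mem_insert.1 he' with rfl | h₂
      · exact absurd rfl hee
      · rw [Function.update_self, Function.update_of_ne (hne e' h₂)]
        exact (hdT e' h₂).symm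
      · rw [Function.update_self, Function.update_of_ne (hne e h₁)]
        exact hdT e h₁
      · rw [Function.update_of_ne (hne e h₁), Function.update_of_ne (hne e' h₂)]
        exact hd e h₁ e' h₂ hee

theorem card_mul_le_of_disjoint_subsets {ι W : Type*} (E : Finset ι) (F : ι → Finset W) (ℓ : ℕ)
    (S : Finset W) (hF : ∀ e ∈ E, F e ⊆ S ∧ #(F e) = ℓ)
    (hd : ∀ e ∈ E, ∀ e' ∈ E, e ≠ e' → Disjoint (F e) (F e')) : #E * ℓ ≤ #S := by
  calc #E * ℓ = ∑ e ∈ E, #(F e) := by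
        rw [Finset.sum_congr rfl fun e he => (hF e he).2, Finset.sum_const, smul_eq_mul]
    _ = #(E.biUnion F) := (Finset.card_biUnion hd).symm
    _ ≤ #S := Finset.card_le_card (Finset.biUnion_subset.2 fun e he => (hF e he).1)

/-- Chopping the traces on `Z` of pairwise disjoint sets into pieces of size `ℓ`. -/
theorem exists_equal_pieces {W : Type*} (𝒢 : Finset (Finset W))
    (h𝒢 : ∀ U ∈ 𝒢, ∀ U' ∈ 𝒢, U ≠ U' → Disjoint U U') (Z : Finset W) {ℓ m : ℕ}
    (hm : m ≤ ∑ U ∈ 𝒢, #(U ∩ Z) / ℓ) :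
    ∃ f par : Fin m → Finset W, (∀ i, par i ∈ 𝒢) ∧ (∀ i, f i ⊆ par i ∩ Z) ∧ (∀ i, #(f i) = ℓ) ∧
      ∀ i j, i ≠ j → Disjoint (f i) (f j) := by
  have hsplit : ∀ U : Finset W, ∃ F : Fin (#(U ∩ Z) / ℓ) → Finset W,
      (∀ e ∈ univ, F e ⊆ U ∩ Z ∧ #(F e) = ℓ) ∧
      ∀ e ∈ univ, ∀ e' ∈ univ, e ≠ e' → Disjoint (F e) (F e') := fun U =>
    exists_disjoint_subsets_card_eq univ (fun _ => ℓ) (U ∩ Z) (by simp [Nat.div_mul_le_self])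
  choose F hF hd using hsplit
  have hcard : Fintype.card (Fin m) ≤ Fintype.card (Σ U : 𝒢, Fin (#(U.1 ∩ Z) / ℓ)) := by
    rw [Fintype.card_sigma]
    simp only [Fintype.card_fin]
    rwa [Finset.sum_coe_sort 𝒢 (fun U => #(U ∩ Z) / ℓ)]
  obtain ⟨g⟩ := Function.Embedding.nonempty_of_card_le hcard
  refine ⟨fun i => F (g i).1 (g i).2, fun i => (g i).1, fun i => (g i).1.2,
    fun i => (hF _ _ (mem_univ _)).1, fun i => (hF _ _ (mem_univ _)).2, ?_⟩
  intro i j hij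
  have hg : g i ≠ g j := fun h => hij (g.injective h)
  dsimp only
  generalize g i = x at hg ⊢
  generalize g j = y at hg ⊢
  obtain ⟨U, e⟩ := x
  obtain ⟨U', e'⟩ := y
  by_cases hU : U = U'
  · subst hU
    exact hd _ _ (mem_univ _) _ (mem_univ _) fun h => hg (congrArg (Sigma.mk U) h)
  · refine Finset.disjoint_of_subset_left ((hF _ _ (mem_univ _)).1.trans Finset.inter_subset_left)
      (Finset.disjoint_of_subset_right ((hF _ _ (mem_univ _)).1.trans Finset.inter_subset_left)
        (h𝒢 _ U.2 _ U'.2 fun h => hU (Subtype.ext h)))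

theorem isUniform_of_subsets {W : Type*} {G : SimpleGraph W} {U U' A B : Finset W} {ε₀ ε : ℝ}
    (h : G.IsUniform ε₀ U U') (hA : A ⊆ U) (hB : B ⊆ U') (hε : ε ≤ 1) (hε₀ : 2 * ε₀ ≤ ε)
    (hcA : #U * ε₀ ≤ #A * ε) (hcB : #U' * ε₀ ≤ #B * ε) : G.IsUniform ε A B := by
  have hA0 : (0 : ℝ) ≤ #A := by positivity
  have hB0 : (0 : ℝ) ≤ #B := by positivity
  intro S hS T hT hcS hcT
  have h1 := h (hS.trans hA) (hT.trans hB) (hcA.trans hcS) (hcB.trans hcT)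
  have h2 := h hA hB (hcA.trans (mul_le_of_le_one_right hA0 hε))
    (hcB.trans (mul_le_of_le_one_right hB0 hε))
  rw [abs_lt] at *
  constructor <;> linarith [h1.1, h1.2, h2.1, h2.2]

theorem sum_card_inter_div_ge {V : Type*} [Fintype V] (P : Finpartition (univ : Finset V))
    (𝒢 : Finset (Finset V)) (h𝒢 : 𝒢 ⊆ P.parts) (Z : Finset V) {σ ℓ : ℕ} (hℓ : 0 < ℓ)
    (hσ : ∀ U ∈ P.parts, #U ≤ σ + 1) :
    #Z ≤ (∑ U ∈ 𝒢, #(U ∩ Z) / ℓ) * ℓ + #P.parts * ℓ + #(P.parts \ 𝒢) * (σ + 1) := by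
  have h1 : #Z = ∑ U ∈ P.parts, #(U ∩ Z) := by
    rw [← Finset.card_biUnion]
    · congr 1
      ext v
      simp only [mem_biUnion, mem_inter]
      constructor
      · intro hv
        obtain ⟨U, hU, hvU⟩ := P.exists_mem (mem_univ v)
        exact ⟨U, hU, hvU, hv⟩
      · rintro ⟨_, _, _, hv⟩
        exact hv
    · intro U hU U' hU' hne
      exact Finset.disjoint_of_subset_left Finset.inter_subset_left
        (Finset.disjoint_of_subset_right Finset.inter_subset_left (P.disjoint hU hU' hne))
  have h2 : ∑ U ∈ P.parts \ 𝒢, #(U ∩ Z) ≤ #(P.parts \ 𝒢) * (σ + 1) := by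
    rw [← smul_eq_mul]
    apply Finset.sum_le_card_nsmul
    intro U hU
    exact (Finset.card_le_card Finset.inter_subset_left).trans (hσ U (mem_sdiff.1 hU).1)
  have h3 : ∑ U ∈ 𝒢, #(U ∩ Z) ≤ (∑ U ∈ 𝒢, #(U ∩ Z) / ℓ) * ℓ + #𝒢 * ℓ := by
    rw [Finset.sum_mul, ← smul_eq_mul (#𝒢), ← Finset.sum_const, ← Finset.sum_add_distrib]
    apply Finset.sum_le_sum
    intro U _
    have := Nat.div_add_mod' (#(U ∩ Z)) ℓ
    have := Nat.mod_lt (#(U ∩ Z)) hℓ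
    omega
  have h4 : #𝒢 * ℓ ≤ #P.parts * ℓ := Nat.mul_le_mul_right _ (Finset.card_le_card h𝒢)
  rw [h1, ← Finset.sum_sdiff h𝒢]
  omega

/-- The parts of an `ε²`-uniform partition that lie in more than `ε k` irregular pairs number
at most `ε k`, where `k` is the number of parts. -/
theorem card_parts_with_many_nonuniform_le {V : Type*} [Fintype V] (G : SimpleGraph V)
    (P : Finpartition (univ : Finset V)) {ε : ℝ} (hε : 0 < ε) (hP : P.IsUniform G (ε ^ 2)) :
    (#{U ∈ P.parts | ε * #P.parts < #{W ∈ P.parts | U ≠ W ∧ ¬ G.IsUniform (ε ^ 2) U W}} : ℝ) ≤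
      ε * #P.parts := by
  set k := #P.parts with hk
  set bad := fun U : Finset V => ({W ∈ P.parts | U ≠ W ∧ ¬ G.IsUniform (ε ^ 2) U W} :
    Finset (Finset V)) with hbad
  set 𝓑 : Finset (Finset V) := {U ∈ P.parts | ε * k < #(bad U)} with h𝓑
  have hk0 : (0 : ℝ) ≤ k := by positivity
  have h1 : ∑ U ∈ P.parts, #(bad U) = #(P.nonUniforms G (ε ^ 2)) := by
    rw [← Finset.card_sigma]
    refine Finset.card_bij (fun x _ => (x.1, x.2)) ?_ ?_ ?_
    · rintro ⟨U, W⟩ h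
      simp only [mem_sigma, hbad, mem_filter] at h
      simpa [Finpartition.mk_mem_nonUniforms] using ⟨h.1, h.2.1, h.2.2.1, h.2.2.2⟩
    · rintro ⟨U, W⟩ _ ⟨U', W'⟩ _ h
      simpa using h
    · rintro ⟨U, W⟩ h
      rw [Finpartition.mk_mem_nonUniforms] at h
      exact ⟨⟨U, W⟩, by simpa [hbad] using ⟨h.1, h.2.1, h.2.2.1, h.2.2.2⟩, rfl⟩
  have h2 : (#𝓑 : ℝ) * (ε * k) ≤ ∑ U ∈ P.parts, (#(bad U) : ℝ) := by
    rw [← nsmul_eq_mul, ← Finset.sum_const]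
    calc _ ≤ ∑ U ∈ 𝓑, (#(bad U) : ℝ) :=
          Finset.sum_le_sum fun U hU => (Finset.mem_filter.1 hU).2.le
      _ ≤ _ := Finset.sum_le_sum_of_subset_of_nonneg (Finset.filter_subset _ _)
          fun _ _ _ => by positivity
  have h3 : (∑ U ∈ P.parts, (#(bad U) : ℝ)) ≤ (ε * k) * (ε * k) := by
    have h4 : (∑ U ∈ P.parts, (#(bad U) : ℝ)) = #(P.nonUniforms G (ε ^ 2)) := by
      exact_mod_cast h1
    rw [h4]
    refine (show (#(P.nonUniforms G (ε ^ 2)) : ℝ) ≤ (k * (k - 1) : ℕ) * ε ^ 2 from hP).trans ?_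
    have : ((k * (k - 1) : ℕ) : ℝ) ≤ (k : ℝ) * k := by
      exact_mod_cast Nat.mul_le_mul_left _ (Nat.sub_le _ _)
    nlinarith [sq_nonneg ε]
  rcases hk0.eq_or_lt with h0 | h0
  · have : #𝓑 ≤ k := Finset.card_le_card (Finset.filter_subset _ _)
    have : (#𝓑 : ℝ) ≤ k := by exact_mod_cast this
    rw [← h0] at this ⊢
    simpa using this
  · exact le_of_mul_le_mul_right (h2.trans h3) (by positivity)

theorem card_pieces_mul_le {V : Type*} {m ℓ σ : ℕ} (f par : Fin m → Finset V)
    (hf : ∀ i, f i ⊆ par i) (hcf : ∀ i, #(f i) = ℓ) (hd : ∀ i j, i ≠ j → Disjoint (f i) (f j))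
    (𝓑 : Finset (Finset V)) (h𝓑 : ∀ U ∈ 𝓑, #U ≤ σ + 1) (J : Finset (Fin m))
    (hJ : ∀ j ∈ J, par j ∈ 𝓑) : #J * ℓ ≤ #𝓑 * (σ + 1) := by
  refine (card_mul_le_of_disjoint_subsets J f ℓ (𝓑.biUnion id)
    (fun e he => ⟨(hf e).trans (Finset.subset_biUnion_of_mem id (hJ e he)), hcf e⟩)
    fun e _ e' _ h => hd e e' h).trans ?_
  exact Finset.card_biUnion_le_card_mul _ _ _ h𝓑

set_option maxHeartbeats 1000000 in
/-- A bipartite degree form of the regularity lemma: up to few vertices, both colour classes are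
cut into equally many clusters of the same size, such that every cluster is in an irregular pair
with few clusters of the opposite class. -/
theorem exists_regular_bipartition {ε : ℝ} (hε : 0 < ε) (hε1 : ε ≤ 1) {M : ℕ} (hM : 0 < M)
    (N : ℕ) :
    ∃ n₀ : ℕ, ∀ (V : Type) [Fintype V] (G : SimpleGraph V) (X Y : Finset V) (n : ℕ), n₀ ≤ n →
      Disjoint X Y → X ∪ Y = univ → #X = n → #Y = n →
      ∃ (m L : ℕ) (A B : Fin m → Finset V) (Reg : Fin m → Fin m → Prop), N ≤ L ∧
        (∀ i, A i ⊆ X) ∧ (∀ j, B j ⊆ Y) ∧ (∀ i, #(A i) = M * L) ∧ (∀ j, #(B j) = M * L) ∧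
        (∀ i i', i ≠ i' → Disjoint (A i) (A i')) ∧ (∀ j j', j ≠ j' → Disjoint (B j) (B j')) ∧
        (1 - ε) * n ≤ m * (M * L : ℕ) ∧ (∀ i j, Reg i j → G.IsUniform ε (A i) (B j)) ∧
        (∀ i, (#{j | ¬ Reg i j} : ℝ) ≤ ε * m) ∧ (∀ j, (#{i | ¬ Reg i j} : ℝ) ≤ ε * m) := by
  set ε₁ : ℝ := ε / 100 with hε₁
  have hε₁0 : 0 < ε₁ := by positivity
  have hε₁1 : ε₁ ≤ 1 / 100 := by rw [hε₁]; linarith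
  set l : ℕ := ⌈1 / ε₁⌉₊ + 1 with hl
  set K := SzemerediRegularity.bound (ε₁ ^ 2) l with hK
  set T : ℕ := ⌈2 * M * (N + 1) / ε₁⌉₊ + 1 with hT
  refine ⟨K * T + l, ?_⟩
  intro V _ G X Y n hn hdisj hcover hX hY
  have hcard : Fintype.card V = 2 * n := by
    rw [← Finset.card_univ, ← hcover, Finset.card_union_of_disjoint hdisj, hX, hY]; ring
  obtain ⟨P, hPe, hPl, hPK, hPu⟩ := szemeredi_regularity G (ε := ε₁ ^ 2) (l := l) (by positivity)
    (by rw [hcard]; omega)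
  set k := #P.parts with hk
  have hk1 : 1 ≤ k := by omega
  set σ := 2 * n / k with hσ
  have hTσ : T ≤ σ := by
    rw [hσ, Nat.le_div_iff_mul_le hk1]
    have : T * k ≤ K * T := by rw [mul_comm]; exact Nat.mul_le_mul_right _ hPK
    omega
  have hσ1 : 1 ≤ σ := by omega
  have hpart : ∀ U ∈ P.parts, #U ≤ σ + 1 := by
    intro U hU
    have := hPe.card_part_le_average_add_one hU
    rwa [Finset.card_univ, hcard] at this
  have hkσ : (k : ℝ) * σ ≤ 2 * n := by exact_mod_cast Nat.mul_div_le (2 * n) k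
  have hkσ' : 2 * (n : ℝ) ≤ k * (σ + 1) := by
    exact_mod_cast (Nat.lt_mul_div_succ (2 * n) hk1).le
  have hkR : (1 : ℝ) ≤ k := by exact_mod_cast hk1
  have hσR : (1 : ℝ) ≤ σ := by exact_mod_cast hσ1
  have hMR : (1 : ℝ) ≤ M := by exact_mod_cast hM
  have hkε : 1 ≤ ε₁ * k := by
    have h1 : 1 / ε₁ ≤ k := by
      refine (Nat.le_ceil _).trans ?_
      exact_mod_cast (by omega : ⌈1 / ε₁⌉₊ ≤ k)
    rwa [div_le_iff₀' hε₁0] at h1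
  have hσε : 2 * M * (N + 1) ≤ ε₁ * σ := by
    have h1 : 2 * M * (N + 1) / ε₁ ≤ σ := by
      refine (Nat.le_ceil _).trans ?_
      exact_mod_cast (by omega : ⌈2 * (M : ℝ) * (N + 1) / ε₁⌉₊ ≤ σ)
    rwa [div_le_iff₀' hε₁0] at h1
  set L : ℕ := ⌊ε₁ * σ / M⌋₊ with hL
  have hNL : N + 1 ≤ L := by
    apply Nat.le_floor
    rw [le_div_iff₀ (by linarith)]
    push_cast
    have : (0 : ℝ) ≤ (M : ℝ) * (N + 1) := by positivity
    linarith
  set ℓ : ℕ := M * L with hℓ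
  have hℓ0 : 0 < ℓ := Nat.mul_pos hM (by omega)
  have hℓR : (0 : ℝ) < ℓ := by exact_mod_cast hℓ0
  have hℓ1 : (ℓ : ℝ) ≤ ε₁ * σ := by
    have := Nat.floor_le (show 0 ≤ ε₁ * σ / M by positivity)
    rw [le_div_iff₀ (by linarith)] at this
    rw [hℓ]; push_cast; linarith
  have hℓ2 : ε₁ * σ ≤ 2 * ℓ := by
    have := Nat.lt_floor_add_one (ε₁ * σ / M)
    rw [div_lt_iff₀ (by linarith)] at this
    have h2 : (M : ℝ) ≤ ℓ := by
      rw [hℓ]; exact_mod_cast Nat.le_mul_of_pos_right M (by omega)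
    have h3 : (ℓ : ℝ) = M * L := by rw [hℓ]; push_cast; ring
    rw [← hL] at this
    linarith
  have hσn : ε₁ * σ ≤ 2 * ε₁ * n := by
    have : (σ : ℝ) ≤ k * σ := le_mul_of_one_le_left (by linarith) hkR
    linarith [mul_le_mul_of_nonneg_left (this.trans hkσ) hε₁0.le]
  have hεkσ : ε₁ * (k * σ) ≤ ε₁ * (2 * n) := mul_le_mul_of_nonneg_left hkσ hε₁0.le
  set bad := fun U : Finset V => ({W ∈ P.parts | U ≠ W ∧ ¬ G.IsUniform (ε₁ ^ 2) U W} :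
    Finset (Finset V)) with hbad
  set 𝒢 : Finset (Finset V) := {U ∈ P.parts | (#(bad U) : ℝ) ≤ ε₁ * k} with h𝒢
  have h𝒢P : 𝒢 ⊆ P.parts := Finset.filter_subset _ _
  have h𝒢c : (#(P.parts \ 𝒢) : ℝ) ≤ ε₁ * k := by
    have h1 : P.parts \ 𝒢 = {U ∈ P.parts | ε₁ * k < #(bad U)} := by
      rw [h𝒢, ← Finset.filter_not]
      exact Finset.filter_congr fun U _ => not_le
    rw [h1]
    exact card_parts_with_many_nonuniform_le G P hε₁0 hPu
  set m : ℕ := ⌊(1 - 6 * ε₁) * n / ℓ⌋₊ with hm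
  have hn0 : (0 : ℝ) ≤ n := by positivity
  have hm1 : (m : ℝ) * ℓ ≤ (1 - 6 * ε₁) * n := by
    have : 0 ≤ (1 - 6 * ε₁) * n := mul_nonneg (by linarith) hn0
    have := Nat.floor_le (show 0 ≤ (1 - 6 * ε₁) * n / ℓ by positivity)
    rwa [le_div_iff₀ hℓR] at this
  have hm2 : (1 - 8 * ε₁) * n ≤ m * ℓ := by
    have := Nat.lt_floor_add_one ((1 - 6 * ε₁) * n / ℓ)
    rw [div_lt_iff₀ hℓR, ← hm] at this
    linarith
  have hside : ∀ Z : Finset V, #Z = n → m ≤ ∑ U ∈ 𝒢, #(U ∩ Z) / ℓ := by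
    intro Z hZ
    have h1 := sum_card_inter_div_ge P 𝒢 h𝒢P Z hℓ0 hpart
    rw [hZ, ← hk] at h1
    set s := ∑ U ∈ 𝒢, #(U ∩ Z) / ℓ
    have h2 : (n : ℝ) ≤ s * ℓ + k * ℓ + #(P.parts \ 𝒢) * (σ + 1) := by exact_mod_cast h1
    have h3 : (#(P.parts \ 𝒢) : ℝ) * (σ + 1) ≤ ε₁ * k * (2 * σ) :=
      mul_le_mul h𝒢c (by linarith) (by linarith) (by positivity)
    have h4 : (k : ℝ) * ℓ ≤ k * (ε₁ * σ) := mul_le_mul_of_nonneg_left hℓ1 (by linarith)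
    have h5 : (m : ℝ) * ℓ ≤ s * ℓ := by linarith
    exact_mod_cast le_of_mul_le_mul_right h5 hℓR
  have hd𝒢 : ∀ U ∈ 𝒢, ∀ U' ∈ 𝒢, U ≠ U' → Disjoint U U' := fun U hU U' hU' hne =>
    P.disjoint (h𝒢P hU) (h𝒢P hU') hne
  obtain ⟨A, pA, hpA, hA, hcA, hdA⟩ := exists_equal_pieces 𝒢 hd𝒢 X (hside X hX)
  obtain ⟨B, pB, hpB, hB, hcB, hdB⟩ := exists_equal_pieces 𝒢 hd𝒢 Y (hside Y hY)
  have hcount : ∀ f par : Fin m → Finset V, (∀ i, f i ⊆ par i) → (∀ i, #(f i) = ℓ) →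
      (∀ i j, i ≠ j → Disjoint (f i) (f j)) → ∀ U ∈ 𝒢, ∀ J : Finset (Fin m),
      (∀ j ∈ J, par j ∈ insert U (bad U)) → (#J : ℝ) ≤ ε * m := by
    intro f par hf hcf hd U hU J hJ
    have h1 := card_pieces_mul_le f par hf hcf hd (insert U (bad U)) (σ := σ) (by
      intro W hW
      rcases Finset.mem_insert.1 hW with rfl | hW
      · exact hpart _ (h𝒢P hU)
      · exact hpart _ (Finset.mem_filter.1 hW).1) J hJ
    have h2 : (#J : ℝ) * ℓ ≤ #(insert U (bad U)) * (σ + 1) := by exact_mod_cast h1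
    have h3 : (#(insert U (bad U)) : ℝ) ≤ 2 * (ε₁ * k) := by
      have h4 : (#(insert U (bad U)) : ℝ) ≤ #(bad U) + 1 := by
        exact_mod_cast Finset.card_insert_le _ _
      have h5 := (Finset.mem_filter.1 hU).2
      linarith
    have h4 : (#(insert U (bad U)) : ℝ) * (σ + 1) ≤ 2 * (ε₁ * k) * (2 * σ) :=
      mul_le_mul h3 (by linarith) (by linarith) (by positivity)
    have h5 : ε * ((1 - 8 * ε₁) * n) ≤ ε * (m * ℓ) := mul_le_mul_of_nonneg_left hm2 hε.le
    have h6 : ε = 100 * ε₁ := by rw [hε₁]; ring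
    have h7 : 50 * ε₁ * n ≤ ε * ((1 - 8 * ε₁) * n) := by
      rw [h6]
      have : ε₁ * (ε₁ * n) ≤ 1 / 100 * (ε₁ * n) :=
        mul_le_mul_of_nonneg_right hε₁1 (by positivity)
      linarith
    have h8 : (#J : ℝ) * ℓ ≤ (ε * m) * ℓ := by
      have : 0 ≤ ε₁ * n := by positivity
      linarith
    exact le_of_mul_le_mul_right h8 hℓR
  refine ⟨m, L, A, B, fun i j => pA i ≠ pB j ∧ G.IsUniform (ε₁ ^ 2) (pA i) (pB j), by omega,
    fun i => (hA i).trans Finset.inter_subset_right,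
    fun i => (hB i).trans Finset.inter_subset_right,
    hcA, hcB, hdA, hdB, ?_, ?_, ?_, ?_⟩
  · refine le_trans (mul_le_mul_of_nonneg_right ?_ hn0) hm2
    rw [hε₁]; linarith
  · rintro i j ⟨-, hU⟩
    have hsize : ∀ U ∈ 𝒢, (#U : ℝ) * ε₁ ^ 2 ≤ ℓ * ε := by
      intro U hU
      have h1 : (#U : ℝ) ≤ σ + 1 := by exact_mod_cast hpart U (h𝒢P hU)
      have h2 : (#U : ℝ) * ε₁ ^ 2 ≤ (2 * σ) * ε₁ ^ 2 :=
        mul_le_mul_of_nonneg_right (by linarith) (by positivity)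
      have h6 : ε = 100 * ε₁ := by rw [hε₁]; ring
      have h7 : ε₁ * (ε₁ * σ) ≤ ε₁ * (2 * ℓ) := mul_le_mul_of_nonneg_left hℓ2 hε₁0.le
      have : 0 ≤ ε₁ * ℓ := by positivity
      rw [h6]
      linarith
    refine isUniform_of_subsets hU ((hA i).trans Finset.inter_subset_left)
      ((hB j).trans Finset.inter_subset_left) hε1 ?_ ?_ ?_
    · have : ε₁ * ε₁ ≤ 1 / 100 * ε₁ := mul_le_mul_of_nonneg_right hε₁1 hε₁0.le
      rw [show ε = 100 * ε₁ by rw [hε₁]; ring]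
      linarith
    · rw [hcA]; exact hsize _ (hpA i)
    · rw [hcB]; exact hsize _ (hpB j)
  · intro i
    refine hcount B pB (fun j => (hB j).trans Finset.inter_subset_left) hcB hdB (pA i) (hpA i) _ ?_
    intro j hj
    simp only [mem_filter, mem_univ, true_and] at hj
    by_cases h : pA i = pB j
    · simp [h]
    · exact Finset.mem_insert_of_mem
        (Finset.mem_filter.2 ⟨h𝒢P (hpB j), h, fun hu => hj ⟨h, hu⟩⟩)
  · intro j
    refine hcount A pA (fun i => (hA i).trans Finset.inter_subset_left) hcA hdA (pB j) (hpB j) _ ?_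
    intro i hi
    simp only [mem_filter, mem_univ, true_and] at hi
    by_cases h : pA i = pB j
    · simp [h]
    · exact Finset.mem_insert_of_mem
        (Finset.mem_filter.2 ⟨h𝒢P (hpA i), Ne.symm h, fun hu => hi ⟨h, hu.symm⟩⟩)

theorem dens_eq_edgeDensity (G : SimpleGraph V) (A B : Finset V) :
    dens G A B = (G.edgeDensity A B : ℝ) := by
  rw [dens, eAB, SimpleGraph.edgeDensity_def, SimpleGraph.interedges_def]
  push_cast
  rfl

theorem eAB_eq_sum_degIn (G : SimpleGraph V) (A B : Finset V) :
    eAB G A B = ∑ x ∈ A, degIn G x B := by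
  simp only [eAB, degIn, Finset.card_filter, Finset.sum_product]

theorem eAB_comm (G : SimpleGraph V) (A B : Finset V) : eAB G A B = eAB G B A := by
  simp only [eAB, Finset.card_filter, Finset.sum_product]
  rw [Finset.sum_comm]
  simp only [G.adj_comm]

theorem dens_comm (G : SimpleGraph V) (A B : Finset V) : dens G A B = dens G B A := by
  rw [dens, dens, eAB_comm, mul_comm]

theorem SuperRegularPair.symm {G : SimpleGraph V} {A B : Finset V} {ε δ : ℝ}
    (h : SuperRegularPair G A B ε δ) : SuperRegularPair G B A ε δ := by
  refine ⟨fun S hS T hT hcS hcT => ?_, h.2.2, h.2.1⟩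
  rw [dens_comm G S, dens_comm G B]
  exact h.1 T hT S hS hcT hcS

theorem epsRegularPair_of_isUniform {G : SimpleGraph V} {A B : Finset V} {ε : ℝ}
    (h : G.IsUniform ε A B) : EpsRegularPair G A B ε := by
  intro S hS T hT hcS hcT
  rw [dens_eq_edgeDensity, dens_eq_edgeDensity]
  exact h hS hT (by linarith) (by linarith)

theorem card_low_degree_le {G : SimpleGraph V} {A B S F : Finset V} {ε d₀ : ℝ}
    (hU : G.IsUniform ε A B) (hd : d₀ ≤ dens G A B) (hε : ε ≤ d₀) (hS : S ⊆ B)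
    (hcS : ε * #B ≤ #S) (hF : F ⊆ A) :
    (#{x ∈ F | (degIn G x S : ℝ) ≤ (d₀ - ε) * #S} : ℝ) ≤ ε * #A := by
  set D : Finset V := {x ∈ F | (degIn G x S : ℝ) ≤ (d₀ - ε) * #S} with hD
  by_contra! hlt
  have h1 := hU ((Finset.filter_subset _ _).trans hF : D ⊆ A) hS (by linarith) (by linarith)
  rw [← dens_eq_edgeDensity, ← dens_eq_edgeDensity, abs_lt] at h1
  have h2 : dens G D S ≤ d₀ - ε := by
    refine div_le_of_le_mul₀ (by positivity) (by linarith) ?_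
    rw [eAB_eq_sum_degIn]
    push_cast
    calc ∑ x ∈ D, (degIn G x S : ℝ) ≤ #D • ((d₀ - ε) * #S) :=
          Finset.sum_le_card_nsmul _ _ _ fun x hx => (Finset.mem_filter.1 hx).2
      _ = _ := by rw [nsmul_eq_mul]; ring
  linarith [h1.1]

theorem degIn_le_degIn_add (G : SimpleGraph V) (x : V) {S T : Finset V} (hT : T ⊆ S) :
    degIn G x S + #T ≤ degIn G x T + #S := by
  have h : degIn G x S ≤ degIn G x T + #(S \ T) := by
    rw [degIn, degIn, ← Finset.sdiff_union_of_subset hT, Finset.filter_union,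
      Finset.sdiff_union_of_subset hT]
    refine (Finset.card_union_le _ _).trans ?_
    rw [add_comm]
    exact Nat.add_le_add_left (Finset.card_filter_le _ _) _
  have := Finset.card_sdiff_add_card_eq_card hT
  omega

theorem exists_subset_sdiff_card_eq {F D : Finset V} {f : ℕ} {x : ℝ} (hD : (#D : ℝ) ≤ x)
    (hf : f + x ≤ #F) : ∃ F₁ ⊆ F \ D, #F₁ = f := by
  apply Finset.exists_subset_card_eq
  have h1 : #F ≤ #(F \ D) + #D := by
    have := Finset.le_card_sdiff D F
    omega
  have h2 : (#F : ℝ) ≤ #(F \ D) + #D := by exact_mod_cast h1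
  exact_mod_cast (by linarith : (f : ℝ) ≤ #(F \ D))

/-- Subsets of a dense regular pair can be trimmed to a super-regular pair of prescribed sizes. -/
theorem exists_superRegular_subpair {G : SimpleGraph V} {A B F F' : Finset V}
    {ε₀ ε τ d d₀ : ℝ} {f f' : ℕ} (hU : G.IsUniform ε₀ A B) (hd₀ : d₀ ≤ dens G A B)
    (hF : F ⊆ A) (hF' : F' ⊆ B) (hf : f + ε₀ * #A ≤ #F) (hf' : f' + ε₀ * #B ≤ #F')
    (hτ : (1 - τ) * #F ≤ f) (hτ' : (1 - τ) * #F' ≤ f')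
    (hfε : ε₀ * #A ≤ ε * f) (hfε' : ε₀ * #B ≤ ε * f')
    (hε₀ : 0 ≤ ε₀) (hε : 2 * ε₀ ≤ ε) (hε1 : ε ≤ 1) (hτ0 : 0 ≤ τ) (hd0 : 0 ≤ d)
    (hd : d + ε₀ + τ ≤ d₀) :
    ∃ F₁ ⊆ F, ∃ F₁' ⊆ F', #F₁ = f ∧ #F₁' = f' ∧ SuperRegularPair G F₁ F₁' ε d := by
  have hA0 : 0 ≤ ε₀ * (#A : ℝ) := by positivity
  have hB0 : 0 ≤ ε₀ * (#B : ℝ) := by positivity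
  have hf0 : (0 : ℝ) ≤ f := by positivity
  have hf0' : (0 : ℝ) ≤ f' := by positivity
  obtain ⟨F₁, hF₁, hc₁⟩ := exists_subset_sdiff_card_eq
    (card_low_degree_le hU hd₀ (by linarith) hF' (by linarith) hF) hf
  obtain ⟨F₁', hF₁', hc₁'⟩ := exists_subset_sdiff_card_eq
    (card_low_degree_le hU.symm (dens_comm G A B ▸ hd₀) (by linarith) hF (by linarith) hF') hf'
  have hs := hF₁.trans Finset.sdiff_subset
  have hs' := hF₁'.trans Finset.sdiff_subset
  have hdeg : ∀ (x : V) (S T : Finset V) (t : ℕ), T ⊆ S → #T = t → (1 - τ) * #S ≤ t →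
      ¬ (degIn G x S : ℝ) ≤ (d₀ - ε₀) * #S → d * #T < degIn G x T := by
    intro x S T t hTS ht hτ hx
    have h1 : (degIn G x S : ℝ) + #T ≤ degIn G x T + #S := by
      exact_mod_cast degIn_le_degIn_add G x hTS
    have h2 : d * (#T : ℝ) ≤ d * #S :=
      mul_le_mul_of_nonneg_left (by exact_mod_cast Finset.card_le_card hTS) hd0
    have h3 : d * (#S : ℝ) ≤ (d₀ - ε₀ - τ) * #S :=
      mul_le_mul_of_nonneg_right (by linarith) (by positivity)
    rw [← ht] at hτ
    linarith
  refine ⟨F₁, hs, F₁', hs', hc₁, hc₁', epsRegularPair_of_isUniform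
    (isUniform_of_subsets hU (hs.trans hF) (hs'.trans hF') hε1 hε ?_ ?_), ?_, ?_⟩
  · rw [hc₁]; linarith
  · rw [hc₁']; linarith
  · intro x hx
    have hx := Finset.mem_sdiff.1 (hF₁ hx)
    exact hdeg x F' F₁' f' hs' hc₁' hτ' fun h => hx.2 (Finset.mem_filter.2 ⟨hx.1, h⟩)
  · intro x hx
    have hx := Finset.mem_sdiff.1 (hF₁' hx)
    exact hdeg x F F₁ f hs hc₁ hτ fun h => hx.2 (Finset.mem_filter.2 ⟨hx.1, h⟩)

theorem card_sdiff_biUnion_le {ι W : Type*} [Fintype ι] {Z : Finset W} {F : ι → Finset W}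
    (hF : ∀ t, F t ⊆ Z) (hd : ∀ t t', t ≠ t' → Disjoint (F t) (F t')) {ε : ℝ}
    (hc : (1 - ε) * #Z ≤ (∑ t, #(F t) : ℕ)) : (#(Z \ univ.biUnion F) : ℝ) ≤ ε * #Z := by
  have h1 : #(Z \ univ.biUnion F) + #(univ.biUnion F) = #Z :=
    Finset.card_sdiff_add_card_eq_card (Finset.biUnion_subset.2 fun t _ => hF t)
  rw [Finset.card_biUnion fun t _ t' _ h => hd t t' h] at h1
  have h2 : (#(Z \ univ.biUnion F) : ℝ) + (∑ t, #(F t) : ℕ) = #Z := by exact_mod_cast h1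
  linarith

/-- A family of disjoint super-regular pairs `(F t, F' t)` across `(X, Y)` that covers most
vertices gives an almost cover; `o t` says which side of the `t`-th pair is the larger one. -/
theorem hasAlmostCover_of_pairs [Fintype V] {G : SimpleGraph V} {X Y : Finset V}
    (hG : BipartiteWith G X Y) {ι : Type*} [Fintype ι] (F F' : ι → Finset V) (o : ι → Bool)
    (s : ι → ℕ) {p q N : ℕ} {ε d : ℝ} (hF : ∀ t, F t ⊆ X) (hF' : ∀ t, F' t ⊆ Y)
    (hd : ∀ t t', t ≠ t' → Disjoint (F t) (F t'))
    (hd' : ∀ t t', t ≠ t' → Disjoint (F' t) (F' t'))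
    (hc : ∀ t, #(F t) = (if o t then q else p) * s t)
    (hc' : ∀ t, #(F' t) = (if o t then p else q) * s t) (hs : ∀ t, N ≤ s t)
    (hX : (1 - ε) * #X ≤ (∑ t, #(F t) : ℕ)) (hY : (1 - ε) * #Y ≤ (∑ t, #(F' t) : ℕ))
    (hreg : ∀ t, SuperRegularPair G (F t) (F' t) ε d) : HasAlmostCover G X Y ε d p q N := by
  have hXY : ∀ v, v ∈ X → v ∉ Y := fun v hv => Finset.disjoint_left.1 hG.disj hv
  set e := (Fintype.equivFin ι).symm
  have hPQ : ∀ t, (if o t then F' t else F t) ∪ (if o t then F t else F' t) = F t ∪ F' t := by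
    intro t
    cases o t
    · simp
    · simp [Finset.union_comm]
  refine ⟨X \ univ.biUnion F, Y \ univ.biUnion F', Fintype.card ι,
    fun i => if o (e i) then F' (e i) else F (e i),
    fun i => if o (e i) then F (e i) else F' (e i), Finset.sdiff_subset, Finset.sdiff_subset,
    card_sdiff_biUnion_le hF hd hX, card_sdiff_biUnion_le hF' hd' hY, ?_, ?_, ?_, ?_, ?_, ?_, ?_⟩
  · simp only [hPQ]
    ext v
    simp only [mem_union, mem_sdiff, mem_biUnion, mem_univ, true_and, iff_true]
    have hv : v ∈ X ∪ Y := hG.cover ▸ mem_univ v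
    by_cases h : ∃ t, v ∈ F t ∨ v ∈ F' t
    · obtain ⟨t, ht⟩ := h
      exact Or.inr ⟨e.symm t, by simpa using ht⟩
    · push Not at h
      left
      rcases Finset.mem_union.1 hv with hv | hv
      · exact Or.inl ⟨hv, fun ⟨t, ht⟩ => (h t).1 ht⟩
      · exact Or.inr ⟨hv, fun ⟨t, ht⟩ => (h t).2 ht⟩
  · intro i
    rw [hPQ, Finset.disjoint_left]
    intro v hv hv'
    simp only [mem_union, mem_sdiff, mem_biUnion, mem_univ, true_and] at hv hv'
    rcases hv with hv | hv <;> rcases hv' with hv' | hv'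
    · exact hv.2 ⟨_, hv'⟩
    · exact hXY v hv.1 (hF' _ hv')
    · exact hXY v (hF _ hv') hv.1
    · exact hv.2 ⟨_, hv'⟩
  · intro i j hij
    have hne : e i ≠ e j := fun h => hij (e.injective h)
    rw [hPQ, hPQ, Finset.disjoint_union_left, Finset.disjoint_union_right,
      Finset.disjoint_union_right]
    exact ⟨⟨hd _ _ hne, Finset.disjoint_of_subset_left (hF _)
      (Finset.disjoint_of_subset_right (hF' _) hG.disj)⟩, Finset.disjoint_of_subset_left (hF' _)
      (Finset.disjoint_of_subset_right (hF _) hG.disj.symm), hd' _ _ hne⟩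
  · intro i
    have := Finset.disjoint_of_subset_left (hF (e i))
      (Finset.disjoint_of_subset_right (hF' (e i)) hG.disj)
    dsimp only
    cases o (e i)
    · simpa using this
    · simpa using this.symm
  · intro i
    have := hreg (e i)
    dsimp only
    cases o (e i)
    · simpa using this
    · simpa using this.symm
  · intro i
    dsimp only
    cases o (e i)
    · simpa using Or.inl ⟨hF (e i), hF' (e i)⟩
    · simpa using Or.inr ⟨hF' (e i), hF (e i)⟩
  · intro i
    have h1 := hc (e i)
    have h2 := hc' (e i)
    have h3 : N * p ≤ p * s (e i) := by rw [mul_comm]; exact Nat.mul_le_mul_left _ (hs _)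
    dsimp only
    cases ho : o (e i) <;> simp only [ho, if_true, if_false, Bool.false_eq_true] at h1 h2 ⊢ <;>
      rw [h1, h2] <;> exact ⟨by ring, h3⟩

/-- An integral tiling of the reduced graph `R` of a regular partition lifts to an almost cover. -/
theorem hasAlmostCover_of_reduced_tiling [Fintype V] {G : SimpleGraph V} {X Y : Finset V}
    (hG : BipartiteWith G X Y) {m L M p q N n : ℕ} {A B : Fin m → Finset V}
    {R : Fin m → Fin m → Prop} {c : Fin m → Fin m → Bool → ℕ} {ε₀ ε τ d d₀ : ℝ}
    (hX : #X = n) (hY : #Y = n) (hp : 0 < p) (hq : 0 < q)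
    (hAX : ∀ i, A i ⊆ X) (hBY : ∀ j, B j ⊆ Y)
    (hcA : ∀ i, #(A i) = M * L) (hcB : ∀ j, #(B j) = M * L)
    (hdA : ∀ i i', i ≠ i' → Disjoint (A i) (A i')) (hdB : ∀ j j', j ≠ j' → Disjoint (B j) (B j'))
    (hn : (1 - ε₀) * n ≤ m * (M * L : ℕ))
    (hU : ∀ i j, R i j → G.IsUniform ε₀ (A i) (B j)) (hR : ∀ i j, R i j → d₀ ≤ dens G (A i) (B j))
    (hcR : ∀ i j o, c i j o ≠ 0 → R i j)
    (hA : ∀ i, ∑ j, ∑ o, (if o then q else p) * c i j o = M)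
    (hB : ∀ j, ∑ i, ∑ o, (if o then p else q) * c i j o = M)
    (hε₀ : 0 ≤ ε₀) (hτ : 0 < τ) (hτ1 : τ ≤ 1 / 2) (hd0 : 0 ≤ d) (hd : d + ε₀ + τ ≤ d₀)
    (hε : 2 * ε₀ ≤ ε) (hετ : ε₀ + τ ≤ ε) (hε1 : ε ≤ 1)
    (hMε : 2 * (ε₀ * M) ≤ ε) (hMτ : 2 * (ε₀ * M) ≤ τ) (hL : 2 / τ ≤ L) (hLN : 2 * N ≤ L) :
    HasAlmostCover G X Y ε d p q N := by
  have hL0 : (0 : ℝ) ≤ L := by positivity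
  have hτL : 2 ≤ τ * L := by rwa [div_le_iff₀' hτ] at hL
  set r := ⌊τ * L⌋₊ with hr
  have hr1 : (r : ℝ) ≤ τ * L := Nat.floor_le (by positivity)
  have hr2 : τ * L ≤ 2 * r := by
    have := Nat.lt_floor_add_one (τ * L)
    linarith
  have hτL2 : τ * L ≤ 1 / 2 * L := mul_le_mul_of_nonneg_right hτ1 hL0
  have hr3 : 2 * r ≤ L := by exact_mod_cast (by linarith : 2 * (r : ℝ) ≤ L)
  set L' := L - r with hL'
  have hL'R : (L' : ℝ) = L - r := by rw [hL', Nat.cast_sub (by omega)]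
  have hpiece : ∀ (E : Fin m → Bool → ℕ) (Z : Finset V), #Z = M * L →
      ∑ j, ∑ o, E j o = M → ∃ F : Fin m × Bool → Finset V,
      (∀ e ∈ univ, F e ⊆ Z ∧ #(F e) = E e.1 e.2 * L) ∧
      ∀ e ∈ univ, ∀ e' ∈ univ, e ≠ e' → Disjoint (F e) (F e') := by
    intro E Z hZ hE
    apply exists_disjoint_subsets_card_eq
    rw [hZ, ← Finset.sum_mul, Fintype.sum_prod_type, hE]
  choose FA hFA hFAd using fun i => hpiece (fun j o => (if o then q else p) * c i j o) (A i)
    (hcA i) (hA i)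
  choose FB hFB hFBd using fun j => hpiece (fun i o => (if o then p else q) * c i j o) (B j)
    (hcB j) (hB j)
  set ι := {t : Fin m × Fin m × Bool // c t.1 t.2.1 t.2.2 ≠ 0} with hι
  have hsize : ∀ k s : ℕ, 0 < k → 0 < s → (k * (s * L') : ℕ) + ε₀ * (M * L : ℕ) ≤ (k * s * L : ℕ) ∧
      (1 - τ) * (k * s * L : ℕ) ≤ (k * (s * L') : ℕ) ∧
      ε₀ * (M * L : ℕ) ≤ ε * (k * (s * L') : ℕ) := by
    intro k s hk hs
    have hks : (1 : ℝ) ≤ (k * s : ℕ) := by exact_mod_cast Nat.mul_pos hk hs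
    push_cast at hks ⊢
    rw [hL'R]
    have h1 : 2 * (ε₀ * M) * L ≤ τ * L := mul_le_mul_of_nonneg_right hMτ hL0
    have h2 : 2 * (ε₀ * M) * L ≤ ε * L := mul_le_mul_of_nonneg_right hMε hL0
    have h3 : (r : ℝ) ≤ (k * s) * r := le_mul_of_one_le_left (by positivity) hks
    have h4 : (k * s : ℝ) * r ≤ k * s * (τ * L) := mul_le_mul_of_nonneg_left hr1 (by positivity)
    have hε0 : 0 ≤ ε := by linarith
    have h5 : ε * (L / 2) ≤ ε * (L - r) := mul_le_mul_of_nonneg_left (by linarith) hε0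
    have h6 : ε * (L - r) ≤ (k * s) * (ε * (L - r)) :=
      le_mul_of_one_le_left (mul_nonneg hε0 (by linarith)) hks
    refine ⟨?_, ?_, ?_⟩ <;> linarith
  have hpos : ∀ o : Bool, 0 < (if o then q else p) ∧ 0 < (if o then p else q) := by
    intro o
    cases o <;> simp [hp, hq]
  have htrim : ∀ t : ι, ∃ F ⊆ FA t.1.1 t.1.2, ∃ F' ⊆ FB t.1.2.1 (t.1.1, t.1.2.2),
      #F = (if t.1.2.2 then q else p) * (c t.1.1 t.1.2.1 t.1.2.2 * L') ∧
      #F' = (if t.1.2.2 then p else q) * (c t.1.1 t.1.2.1 t.1.2.2 * L') ∧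
      SuperRegularPair G F F' ε d := by
    rintro ⟨⟨i, j, o⟩, ht⟩
    have h1 := hFA i (j, o) (mem_univ _)
    have h2 := hFB j (i, o) (mem_univ _)
    have s1 := hsize _ _ (hpos o).1 (Nat.pos_of_ne_zero ht)
    have s2 := hsize _ _ (hpos o).2 (Nat.pos_of_ne_zero ht)
    refine exists_superRegular_subpair (hU i j (hcR i j o ht)) (hR i j (hcR i j o ht)) h1.1 h2.1
      ?_ ?_ ?_ ?_ ?_ ?_ hε₀ hε hε1 hτ.le hd0 hd
    · rw [hcA, h1.2]; exact s1.1
    · rw [hcB, h2.2]; exact s2.1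
    · rw [h1.2]; exact s1.2.1
    · rw [h2.2]; exact s2.2.1
    · rw [hcA]; exact s1.2.2
    · rw [hcB]; exact s2.2.2
  choose F hF F' hF' hcF hcF' hreg using htrim
  have hcover : (1 - ε) * n ≤ (m * (M * L') : ℕ) := by
    have h1 : (1 - τ) * ((1 - ε₀) * n) ≤ (1 - τ) * (m * (M * L : ℕ)) :=
      mul_le_mul_of_nonneg_left hn (by linarith)
    have h2 : (m * M : ℝ) * ((1 - τ) * L) ≤ m * M * L' :=
      mul_le_mul_of_nonneg_left (by rw [hL'R]; linarith) (by positivity)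
    have h3 : (1 - ε) * (n : ℝ) ≤ (1 - τ) * (1 - ε₀) * n :=
      mul_le_mul_of_nonneg_right (by linarith [mul_nonneg hτ.le hε₀]) (by positivity)
    push_cast at h1 ⊢
    linarith
  have hsum : ∀ κ : Bool → ℕ, (∑ t : ι, κ t.1.2.2 * (c t.1.1 t.1.2.1 t.1.2.2 * L')) =
      ∑ i, ∑ j, ∑ o, κ o * c i j o * L' := by
    intro κ
    rw [← Finset.sum_subtype {t : Fin m × Fin m × Bool | c t.1 t.2.1 t.2.2 ≠ 0} (by simp)
      fun t : Fin m × Fin m × Bool => κ t.2.2 * (c t.1 t.2.1 t.2.2 * L'), Finset.sum_filter_of_ne]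
    · simp only [Fintype.sum_prod_type, mul_assoc]
    · intro t _ h h0
      exact h (by simp [h0])
  refine hasAlmostCover_of_pairs hG F F' (fun t => t.1.2.2)
    (fun t => c t.1.1 t.1.2.1 t.1.2.2 * L')
    (fun t => ((hF t).trans (hFA _ _ (mem_univ _)).1).trans (hAX _))
    (fun t => ((hF' t).trans (hFB _ _ (mem_univ _)).1).trans (hBY _)) ?_ ?_ hcF hcF' ?_ ?_ ?_ hreg
  · intro t t' hne
    by_cases h : t.1.1 = t'.1.1
    · refine Finset.disjoint_of_subset_left (hF t) (Finset.disjoint_of_subset_right (hF t') ?_)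
      rw [← h]
      exact hFAd _ _ (mem_univ _) _ (mem_univ _) fun h' => hne (Subtype.ext (Prod.ext h h'))
    · exact Finset.disjoint_of_subset_left ((hF t).trans (hFA _ _ (mem_univ _)).1)
        (Finset.disjoint_of_subset_right ((hF t').trans (hFA _ _ (mem_univ _)).1) (hdA _ _ h))
  · intro t t' hne
    by_cases h : t.1.2.1 = t'.1.2.1
    · refine Finset.disjoint_of_subset_left (hF' t) (Finset.disjoint_of_subset_right (hF' t') ?_)
      rw [← h]
      refine hFBd _ _ (mem_univ _) _ (mem_univ _) fun h' => hne (Subtype.ext ?_)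
      exact Prod.ext (Prod.ext_iff.1 h').1 (Prod.ext h (Prod.ext_iff.1 h').2)
    · exact Finset.disjoint_of_subset_left ((hF' t).trans (hFB _ _ (mem_univ _)).1)
        (Finset.disjoint_of_subset_right ((hF' t').trans (hFB _ _ (mem_univ _)).1) (hdB _ _ h))
  · intro t
    have h1 : N ≤ L' := by omega
    exact h1.trans (Nat.le_mul_of_pos_left _ (Nat.pos_of_ne_zero t.2))
  · rw [Finset.sum_congr rfl fun t _ => hcF t, hsum fun o => if o then q else p, hX]
    simp only [← Finset.sum_mul, hA, Finset.sum_const, card_univ, Fintype.card_fin, smul_eq_mul]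
    simpa only [mul_assoc] using hcover
  · rw [Finset.sum_congr rfl fun t _ => hcF' t, hsum fun o => if o then p else q, hY,
      Finset.sum_comm]
    simp only [← Finset.sum_mul, hB, Finset.sum_const, card_univ, Fintype.card_fin, smul_eq_mul]
    simpa only [mul_assoc] using hcover

theorem eAB_le_card_mul_card (G : SimpleGraph V) (A B : Finset V) : eAB G A B ≤ #A * #B :=
  (Finset.card_filter_le _ _).trans_eq (Finset.card_product A B)

theorem eAB_biUnion_right_le {ι : Type*} (G : SimpleGraph V) (A : Finset V) (T : Finset ι)
    (B : ι → Finset V) : eAB G A (T.biUnion B) ≤ ∑ j ∈ T, eAB G A (B j) := by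
  refine (Finset.card_le_card ?_).trans Finset.card_biUnion_le
  intro x
  simp only [mem_filter, mem_product, mem_biUnion]
  rintro ⟨⟨hx, j, hj, hxj⟩, hadj⟩
  exact ⟨j, hj, ⟨hx, hxj⟩, hadj⟩

theorem eAB_biUnion_left_le {ι : Type*} (G : SimpleGraph V) (B : Finset V) (S : Finset ι)
    (A : ι → Finset V) : eAB G (S.biUnion A) B ≤ ∑ i ∈ S, eAB G (A i) B := by
  simp only [eAB_comm G _ B]
  exact eAB_biUnion_right_le G B S A

theorem eAB_le_add_sdiff_right (G : SimpleGraph V) (A B C : Finset V) :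
    eAB G A B ≤ eAB G A C + #A * #(B \ C) := by
  rw [← Finset.card_product]
  refine (Finset.card_le_card ?_).trans (Finset.card_union_le _ _)
  intro x
  simp only [mem_filter, mem_product, mem_union, mem_sdiff]
  tauto

theorem eAB_le_add_sdiff_left (G : SimpleGraph V) (A B C : Finset V) :
    eAB G A B ≤ eAB G C B + #(A \ C) * #B := by
  rw [eAB_comm, eAB_comm G C, mul_comm]
  exact eAB_le_add_sdiff_right G B A C

/-- The number of edges between `A` and the clusters `B j`, `j ∈ T`, when all regular pairs
`(A, B j)` with `j ∈ T` are sparse. -/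
theorem sum_eAB_le {m ℓ : ℕ} {G : SimpleGraph V} {A : Finset V} {B : Fin m → Finset V}
    {Reg : Fin m → Prop} {ε₀ d₀ : ℝ} (hA : #A = ℓ) (hB : ∀ j, #(B j) = ℓ)
    (hReg : (#{j | ¬ Reg j} : ℝ) ≤ ε₀ * m) (hd₀ : 0 ≤ d₀) (T : Finset (Fin m))
    (hT : ∀ j ∈ T, Reg j → dens G A (B j) ≤ d₀) :
    ∑ j ∈ T, (eAB G A (B j) : ℝ) ≤ (ε₀ + d₀) * m * (ℓ : ℝ) ^ 2 := by
  have h1 : ∀ j ∈ T, (eAB G A (B j) : ℝ) ≤ (if ¬ Reg j then (ℓ : ℝ) ^ 2 else 0) + d₀ * ℓ ^ 2 := by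
    intro j hj
    have h0 : (eAB G A (B j) : ℝ) ≤ (ℓ : ℝ) ^ 2 := by
      have := eAB_le_card_mul_card G A (B j)
      rw [hA, hB, ← sq] at this
      exact_mod_cast this
    have hnn : 0 ≤ d₀ * (ℓ : ℝ) ^ 2 := by positivity
    by_cases h : Reg j
    · have h2 := hT j hj h
      rw [if_neg (not_not.2 h), zero_add]
      rcases Nat.eq_zero_or_pos ℓ with hℓ | hℓ
      · rw [hℓ] at h0
        exact (h0.trans (by simp)).trans hnn
      · rw [dens, hA, hB, ← sq, div_le_iff₀ (by positivity)] at h2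
        exact h2
    · rw [if_pos h]
      linarith
  calc ∑ j ∈ T, (eAB G A (B j) : ℝ)
      ≤ ∑ j ∈ T, ((if ¬ Reg j then (ℓ : ℝ) ^ 2 else 0) + d₀ * ℓ ^ 2) := Finset.sum_le_sum h1
    _ ≤ ∑ j, ((if ¬ Reg j then (ℓ : ℝ) ^ 2 else 0) + d₀ * ℓ ^ 2) := by
        refine Finset.sum_le_sum_of_subset_of_nonneg (Finset.subset_univ _) fun j _ _ => ?_
        split_ifs <;> positivity
    _ = #{j | ¬ Reg j} * (ℓ : ℝ) ^ 2 + m * (d₀ * ℓ ^ 2) := by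
        rw [Finset.sum_add_distrib, ← Finset.sum_filter, Finset.sum_const, Finset.sum_const,
          nsmul_eq_mul, nsmul_eq_mul, Finset.card_univ, Fintype.card_fin]
    _ ≤ ε₀ * m * (ℓ : ℝ) ^ 2 + m * (d₀ * ℓ ^ 2) := by gcongr
    _ = _ := by ring

theorem card_reduced_neighbors_ge {m ℓ n : ℕ} {G : SimpleGraph V} {A Y : Finset V}
    {B : Fin m → Finset V} {Reg : Fin m → Prop} {ε₀ d₀ δ : ℝ} (hℓ : 0 < ℓ) (hA : #A = ℓ)
    (hBY : ∀ j, B j ⊆ Y) (hB : ∀ j, #(B j) = ℓ) (hdB : ∀ j j', j ≠ j' → Disjoint (B j) (B j'))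
    (hY : #Y = n) (hn : (1 - ε₀) * n ≤ m * ℓ) (hReg : (#{j | ¬ Reg j} : ℝ) ≤ ε₀ * m)
    (hε₀ : 0 ≤ ε₀) (hε₀1 : ε₀ ≤ 1 / 2) (hd₀ : 0 ≤ d₀) (hδ : 0 ≤ δ)
    (hdeg : ∀ x ∈ A, δ * n ≤ degIn G x Y) :
    (δ - 3 * ε₀ - d₀) * m ≤ #{j | Reg j ∧ d₀ ≤ dens G A (B j)} := by
  set D : Finset (Fin m) := {j | Reg j ∧ d₀ ≤ dens G A (B j)} with hD
  have hℓR : (0 : ℝ) < ℓ := by exact_mod_cast hℓ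
  have hU : #(univ.biUnion B) = m * ℓ := by
    rw [Finset.card_biUnion fun j _ j' _ h => hdB j j' h, Finset.sum_congr rfl fun j _ => hB j]
    simp
  have hc : #(Y \ univ.biUnion B) + m * ℓ = n := by
    rw [← hU, ← hY]
    exact Finset.card_sdiff_add_card_eq_card (Finset.biUnion_subset.2 fun j _ => hBY j)
  have hcR : (#(Y \ univ.biUnion B) : ℝ) + m * ℓ = n := by exact_mod_cast hc
  have h1 : ℓ * (δ * n) ≤ (eAB G A Y : ℝ) := by
    rw [eAB_eq_sum_degIn, ← hA, ← nsmul_eq_mul]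
    push_cast
    exact Finset.card_nsmul_le_sum _ _ _ hdeg
  have h2 : (eAB G A Y : ℝ) ≤ ∑ j, (eAB G A (B j) : ℝ) + ℓ * #(Y \ univ.biUnion B) := by
    have := (eAB_le_add_sdiff_right G A Y (univ.biUnion B)).trans
      (Nat.add_le_add_right (eAB_biUnion_right_le G A univ B) _)
    rw [hA] at this
    exact_mod_cast this
  have h3 : ∑ j ∈ univ \ D, (eAB G A (B j) : ℝ) ≤ (ε₀ + d₀) * m * (ℓ : ℝ) ^ 2 := by
    refine sum_eAB_le hA hB hReg hd₀ _ fun j hj hr => ?_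
    by_contra! h
    exact (Finset.mem_sdiff.1 hj).2 (Finset.mem_filter.2 ⟨mem_univ _, hr, h.le⟩)
  have h4 : ∑ j ∈ D, (eAB G A (B j) : ℝ) ≤ #D * (ℓ : ℝ) ^ 2 := by
    rw [← nsmul_eq_mul]
    refine Finset.sum_le_card_nsmul _ _ _ fun j _ => ?_
    have := eAB_le_card_mul_card G A (B j)
    rw [hA, hB, ← sq] at this
    exact_mod_cast this
  have h5 := Finset.sum_sdiff (f := fun j => (eAB G A (B j) : ℝ)) (Finset.subset_univ D)
  have h6 : δ * (m * ℓ) ≤ δ * n :=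
    mul_le_mul_of_nonneg_left (by linarith [Nat.cast_nonneg (α := ℝ) #(Y \ univ.biUnion B)]) hδ
  have h7 : (#(Y \ univ.biUnion B) : ℝ) ≤ 2 * ε₀ * (m * ℓ) := by
    have h8 : 1 / 2 * (n : ℝ) ≤ (1 - ε₀) * n :=
      mul_le_mul_of_nonneg_right (by linarith) (by positivity)
    have h9 : ε₀ * (n : ℝ) ≤ ε₀ * (2 * (m * ℓ)) := mul_le_mul_of_nonneg_left (by linarith) hε₀
    linarith
  have h8 : (ℓ : ℝ) * (δ * (m * ℓ)) ≤
      (ε₀ + d₀) * m * (ℓ : ℝ) ^ 2 + #D * (ℓ : ℝ) ^ 2 + ℓ * (2 * ε₀ * (m * ℓ)) := by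
    have h9 := mul_le_mul_of_nonneg_left h6 hℓR.le
    have h10 := mul_le_mul_of_nonneg_left h7 hℓR.le
    linarith
  refine le_of_mul_le_mul_right ?_ (show (0 : ℝ) < (ℓ : ℝ) ^ 2 by positivity)
  linarith

theorem exists_card_eq_card_sdiff_le {X A : Finset V} {s : ℕ} {t : ℝ} (hAX : A ⊆ X)
    (hs : s ≤ #X) (ht : 0 ≤ t) (hA : s ≤ #A + t) :
    ∃ A₁ ⊆ X, #A₁ = s ∧ (#(A₁ \ A) : ℝ) ≤ t := by
  rcases le_total s #A with h | h
  · obtain ⟨A₁, h₁, hc⟩ := Finset.exists_subset_card_eq h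
    refine ⟨A₁, h₁.trans hAX, hc, ?_⟩
    rw [Finset.sdiff_eq_empty_iff_subset.2 h₁]
    simpa using ht
  · obtain ⟨A₁, h₁, h₂, hc⟩ := Finset.exists_subsuperset_card_eq hAX h hs
    refine ⟨A₁, h₂, hc, ?_⟩
    have := Finset.card_sdiff_add_card_eq_card h₁
    have : (#(A₁ \ A) : ℝ) + #A = s := by exact_mod_cast this.trans hc
    linarith

theorem extremalWith_of_sparse_pair [Fintype V] {G : SimpleGraph V} {X Y A B : Finset V}
    {n w h : ℕ} {η a : ℝ} (hX : #X = n) (hY : #Y = n) (hn : 6 ≤ n) (hh : 0 < h) (hwh : w ≤ h)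
    (hhw : h ≤ 2 * w) (hAX : A ⊆ X) (hBY : B ⊆ Y) (hη : 0 ≤ η)
    (hA : ((w : ℝ) / h - η) * n ≤ #A) (hB : ((w : ℝ) / h - η) * n ≤ #B)
    (he : (eAB G A B : ℝ) ≤ η * n ^ 2) (ha : 27 * η ≤ a) : ExtremalWith G X Y w h a := by
  set s := w * n / h with hs
  have hhR : (0 : ℝ) < h := by exact_mod_cast hh
  have hsn : s ≤ n := by
    rw [hs]
    exact Nat.div_le_of_le_mul (Nat.mul_le_mul_right _ hwh)
  have hs1 : (s : ℝ) ≤ (w : ℝ) / h * n := by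
    have := Nat.cast_div_le (α := ℝ) (m := w * n) (n := h)
    push_cast at this
    rwa [div_mul_eq_mul_div]
  have hs2 : n ≤ 3 * s := by
    have h1 : n / 2 ≤ s := by
      rw [hs, Nat.le_div_iff_mul_le hh]
      have h2 : n / 2 * h ≤ n / 2 * (2 * w) := Nat.mul_le_mul_left _ hhw
      have h3 : n / 2 * 2 * w ≤ n * w := Nat.mul_le_mul_right _ (Nat.div_mul_le_self n 2)
      linarith
    omega
  have hηn : 0 ≤ η * n := by positivity
  obtain ⟨A₁, hA₁, hcA, hdA⟩ := exists_card_eq_card_sdiff_le hAX (hX ▸ hsn) hηn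
    (by linarith : (s : ℝ) ≤ #A + η * n)
  obtain ⟨B₁, hB₁, hcB, hdB⟩ := exists_card_eq_card_sdiff_le hBY (hY ▸ hsn) hηn
    (by linarith : (s : ℝ) ≤ #B + η * n)
  refine ⟨A₁, hA₁, B₁, hB₁, by rw [hX, hcA], by rw [hX, hcB], ?_⟩
  have h1 : (eAB G A₁ B₁ : ℝ) ≤ eAB G A B + #A * #(B₁ \ B) + #(A₁ \ A) * #B₁ := by
    have := (eAB_le_add_sdiff_left G A₁ B₁ A).trans
      (Nat.add_le_add_right (eAB_le_add_sdiff_right G A B₁ B) _)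
    exact_mod_cast this
  have hAn : (#A : ℝ) ≤ n := by exact_mod_cast hX ▸ Finset.card_le_card hAX
  have hBn : (#B₁ : ℝ) ≤ n := by exact_mod_cast hY ▸ Finset.card_le_card hB₁
  have h2 : (#A : ℝ) * #(B₁ \ B) ≤ n * (η * n) :=
    mul_le_mul hAn hdB (by positivity) (by positivity)
  have h3 : (#(A₁ \ A) : ℝ) * #B₁ ≤ η * n * n := mul_le_mul hdA hBn (by positivity) hηn
  have h4 : (eAB G A₁ B₁ : ℝ) ≤ 3 * η * n ^ 2 := by linarith
  have hs2R : (n : ℝ) ≤ 3 * s := by exact_mod_cast hs2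
  have hs0 : (0 : ℝ) < s := by exact_mod_cast (by omega : 0 < s)
  have h5 : (n : ℝ) ^ 2 ≤ (3 * s) ^ 2 := by gcongr
  rw [dens, hcA, hcB, div_le_iff₀ (by positivity)]
  have h6 : 3 * η * (n : ℝ) ^ 2 ≤ 3 * η * (3 * s) ^ 2 := by gcongr
  have h7 : 27 * η * ((s : ℝ) * s) ≤ a * (s * s) := by gcongr
  linarith

theorem extremalWith_of_reduced_empty_pair [Fintype V] {G : SimpleGraph V} {X Y : Finset V}
    {m ℓ n w h : ℕ} {A B : Fin m → Finset V} {Reg : Fin m → Fin m → Prop} {ε₀ d₀ β η a : ℝ}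
    (hX : #X = n) (hY : #Y = n) (hn : 6 ≤ n) (hh : 0 < h) (hwh : w ≤ h) (hhw : h ≤ 2 * w)
    (hAX : ∀ i, A i ⊆ X) (hBY : ∀ j, B j ⊆ Y) (hA : ∀ i, #(A i) = ℓ) (hB : ∀ j, #(B j) = ℓ)
    (hdA : ∀ i i', i ≠ i' → Disjoint (A i) (A i')) (hdB : ∀ j j', j ≠ j' → Disjoint (B j) (B j'))
    (hmn : (1 - ε₀) * n ≤ m * ℓ) (hReg : ∀ i, (#{j | ¬ Reg i j} : ℝ) ≤ ε₀ * m)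
    (hε₀ : 0 ≤ ε₀) (hd₀ : 0 ≤ d₀) (hβ : 0 ≤ β) (hβ1 : β ≤ 1) (hβη : (w : ℝ) / h - η + ε₀ ≤ β)
    (hη : ε₀ + d₀ ≤ η) (ha : 27 * η ≤ a) {S T : Finset (Fin m)} (hS : β * m ≤ #S)
    (hT : β * m ≤ #T) (hST : ∀ i ∈ S, ∀ j ∈ T, ¬ (Reg i j ∧ d₀ ≤ dens G (A i) (B j))) :
    ExtremalWith G X Y w h a := by
  have hn0 : (0 : ℝ) ≤ n := by positivity
  have hcard : ∀ (C : Fin m → Finset V) (S : Finset (Fin m)), (∀ i, #(C i) = ℓ) →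
      (∀ i i', i ≠ i' → Disjoint (C i) (C i')) → #(S.biUnion C) = #S * ℓ := by
    intro C S hC hd
    rw [Finset.card_biUnion fun j _ j' _ h => hd j j' h, Finset.sum_congr rfl fun j _ => hC j]
    simp
  have hbig : ∀ (C : Fin m → Finset V) (S : Finset (Fin m)), (∀ i, #(C i) = ℓ) →
      (∀ i i', i ≠ i' → Disjoint (C i) (C i')) → β * m ≤ #S →
      ((w : ℝ) / h - η) * n ≤ #(S.biUnion C) := by
    intro C S hC hd hS
    rw [hcard C S hC hd]
    push_cast
    have h1 : β * m * (ℓ : ℝ) ≤ #S * ℓ := mul_le_mul_of_nonneg_right hS (by positivity)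
    have h2 : β * ((1 - ε₀) * n) ≤ β * (m * ℓ) := mul_le_mul_of_nonneg_left hmn hβ
    have h3 : β * (ε₀ * n) ≤ 1 * (ε₀ * n) := mul_le_mul_of_nonneg_right hβ1 (by positivity)
    have h4 : ((w : ℝ) / h - η + ε₀) * n ≤ β * n := mul_le_mul_of_nonneg_right hβη hn0
    linarith
  have hmℓ : (m : ℝ) * ℓ ≤ n := by
    have := Finset.card_le_card (Finset.biUnion_subset.2 fun i (_ : i ∈ univ) => hAX i)
    rw [hcard A univ hA hdA, Finset.card_univ, Fintype.card_fin, hX] at this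
    exact_mod_cast this
  refine extremalWith_of_sparse_pair (A := S.biUnion A) (B := T.biUnion B) hX hY hn hh hwh hhw
    (Finset.biUnion_subset.2 fun i _ => hAX i) (Finset.biUnion_subset.2 fun j _ => hBY j)
    (by linarith) (hbig A S hA hdA hS) (hbig B T hB hdB hT) ?_ ha
  have h1 : (eAB G (S.biUnion A) (T.biUnion B) : ℝ) ≤
      ∑ i ∈ S, ∑ j ∈ T, (eAB G (A i) (B j) : ℝ) := by
    exact_mod_cast (eAB_biUnion_left_le G _ S A).trans
      (Finset.sum_le_sum fun i _ => eAB_biUnion_right_le G (A i) T B)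
  have h2 : ∑ i ∈ S, ∑ j ∈ T, (eAB G (A i) (B j) : ℝ) ≤ #S • ((ε₀ + d₀) * m * (ℓ : ℝ) ^ 2) := by
    refine Finset.sum_le_card_nsmul _ _ _ fun i hi => ?_
    refine sum_eAB_le (hA i) hB (hReg i) hd₀ T fun j hj hr => ?_
    by_contra! hlt
    exact hST i hi j hj ⟨hr, hlt.le⟩
  have h3 : (#S : ℝ) ≤ m := by
    exact_mod_cast (Finset.card_le_univ S).trans_eq (Fintype.card_fin m)
  calc (eAB G (S.biUnion A) (T.biUnion B) : ℝ)
      ≤ #S * ((ε₀ + d₀) * m * (ℓ : ℝ) ^ 2) := by rw [← nsmul_eq_mul]; exact h1.trans h2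
    _ ≤ m * ((ε₀ + d₀) * m * (ℓ : ℝ) ^ 2) := by gcongr
    _ = (ε₀ + d₀) * (m * ℓ) ^ 2 := by ring
    _ ≤ η * n ^ 2 := by gcongr; linarith

theorem BipartiteWith.degree_le_degIn [Fintype V] {G : SimpleGraph V} {X Y : Finset V}
    (hG : BipartiteWith G X Y) {x : V} (hx : x ∈ X) : G.degree x ≤ degIn G x Y := by
  refine Finset.card_le_card fun y hy => ?_
  have hxy : G.Adj x y := (G.mem_neighborFinset x y).1 hy
  rcases hG.cross hxy with h | h
  · exact Finset.mem_filter.2 ⟨h.2, hxy⟩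
  · exact absurd h.1 (Finset.disjoint_left.1 hG.disj hx)

theorem BipartiteWith.symm [Fintype V] {G : SimpleGraph V} {X Y : Finset V}
    (hG : BipartiteWith G X Y) : BipartiteWith G Y X :=
  ⟨hG.disj.symm, by rw [Finset.union_comm, hG.cover], fun _ _ h => (hG.cross h).symm⟩

theorem exists_tiling_parameter (w h : ℕ) (hh : 0 < h) {a : ℝ} (ha : 0 < a) :
    ∃ z : ℕ, w + 1 ≤ z ∧ 0 < (1 : ℝ) / z ∧ 1 / (z : ℝ) < a ∧ 162 * w * (1 / (z : ℝ)) ≤ a ∧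
      5 * h * (1 / (z : ℝ)) ≤ 1 := by
  set c : ℕ := ⌈(162 * w + 1) / a⌉₊ with hc
  refine ⟨w + 1 + c + 5 * h, by omega, by positivity, ?_⟩
  have h1 : (162 * w + 1) / a ≤ c := Nat.le_ceil _
  rw [div_le_iff₀ ha] at h1
  have hw : (0 : ℝ) ≤ w := by positivity
  have hhR : (0 : ℝ) ≤ h := by positivity
  have hcR : (0 : ℝ) ≤ c := by positivity
  push_cast
  have hz : (0 : ℝ) < w + 1 + c + 5 * h := by positivity
  have h2 : 0 ≤ (w + 5 * h : ℝ) * a := by positivity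
  refine ⟨?_, ?_, ?_⟩
  · rw [div_lt_iff₀ hz]; linarith
  · rw [mul_one_div, div_le_iff₀ hz]; linarith
  · rw [mul_one_div, div_le_iff₀ hz]; linarith

/-- Lemma 4.4. Let `w > u ≥ 1` and `h = u + w`. For every `a > 0` and
positive integer `N` there exist `n₀` and constants `0 < ε < d < γ < a` with `γ = 1/z` for an
integer `z` (so that `p = uz + w` and `q = wz` are integers) such that every balanced bipartite
graph `G[X,Y]` on `2n` vertices with `n ≥ n₀` and `δ(G) ≥ (u/h - γ)n` is either in the extremal
case with parameter `a`, or contains an almost `(ε,d,p,q,N)`-cover. -/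
theorem statement_11 (u w h : ℕ) (hu : 0 < u) (huw : u < w) (hh : h = u + w)
    (a : ℝ) (ha : 0 < a) (N : ℕ) (hN : 0 < N) :
    ∃ (n₀ z : ℕ) (ε d γ : ℝ),
      0 < ε ∧ ε < d ∧ d < γ ∧ γ < a ∧ γ = 1 / (z : ℝ) ∧
      ∀ (V : Type) [Fintype V], ∀ (G : SimpleGraph V) (X Y : Finset V) (n : ℕ),
        n₀ ≤ n → BipartiteWith G X Y → X.card = n → Y.card = n →
        (∀ v : V, ((u : ℝ) / h - γ) * n ≤ G.degree v) →
        ExtremalWith G X Y w h a ∨ HasAlmostCover G X Y ε d (u * z + w) (w * z) N := by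
  have hh0 : 0 < h := by omega
  have hw0 : 0 < w := by omega
  have hhR : (0 : ℝ) < h := by exact_mod_cast hh0
  have hwR : (1 : ℝ) ≤ w := by exact_mod_cast hw0
  have huR : (1 : ℝ) ≤ u := by exact_mod_cast hu
  obtain ⟨z, hz, hγ0, hγa, hγw, hγh⟩ := exists_tiling_parameter w h hh0 ha
  set γ : ℝ := 1 / z with hγ
  have hz0 : 0 < z := by omega
  have hpq : u * z + w < w * z := by
    have : (u + 1) * z ≤ w * z := Nat.mul_le_mul_right _ huw
    linarith
  set p := u * z + w with hp
  set q := w * z with hq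
  have hp0 : 0 < p := by omega
  set M := (q ^ 2 - p ^ 2) * q.factorial ^ 2 with hM
  have hM0 : 0 < M := by
    have : p ^ 2 < q ^ 2 := Nat.pow_lt_pow_left hpq two_ne_zero
    exact Nat.mul_pos (by omega) (pow_pos q.factorial_pos 2)
  have hMR : (1 : ℝ) ≤ M := by exact_mod_cast hM0
  have hγ1 : γ ≤ 1 / 5 := by
    have : (1 : ℝ) ≤ h := by exact_mod_cast hh0
    have := le_mul_of_one_le_left hγ0.le this
    linarith
  set ε₀ : ℝ := γ / (32 * M) with hε₀
  have hε₀0 : 0 < ε₀ := by positivity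
  have hε₀M : 32 * (ε₀ * M) = γ := by
    rw [hε₀]
    field_simp
  have hε₀γ : 32 * ε₀ ≤ γ := by
    rw [← hε₀M]
    linarith [le_mul_of_one_le_right hε₀0.le hMR]
  obtain ⟨n₁, hn₁⟩ := exists_regular_bipartition hε₀0 (by linarith) hM0 (2 * N + ⌈2 / (γ / 16)⌉₊)
  refine ⟨max n₁ 6, z, γ / 8, γ / 4, γ, by linarith, by linarith, by linarith, hγa, rfl, ?_⟩
  intro V _ G X Y n hn hG hX hY hdeg
  obtain ⟨m, L, A, B, Reg, hL, hAX, hBY, hcA, hcB, hdA, hdB, hmn, hU, hRA, hRB⟩ :=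
    hn₁ V G X Y n ((le_max_left _ _).trans hn) hG.disj hG.cover hX hY
  have hℓ : 0 < M * L := Nat.mul_pos hM0 (by omega)
  have huh : γ ≤ (u : ℝ) / h := by
    rw [le_div_iff₀ hhR]
    linarith
  have hwh : 5 * w * γ ≤ (w : ℝ) / h := by
    rw [le_div_iff₀ hhR]
    linarith [mul_le_mul_of_nonneg_left hγh (by linarith : (0 : ℝ) ≤ w)]
  have hwγ : γ ≤ w * γ := le_mul_of_one_le_left hγ0.le hwR
  have hwh1 : (w : ℝ) / h ≤ 1 := by
    rw [div_le_one hhR]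
    exact_mod_cast (by omega : w ≤ h)
  set R : Fin m → Fin m → Prop := fun i j => Reg i j ∧ γ / 2 ≤ dens G (A i) (B j) with hR
  by_cases hne : ∃ S T : Finset (Fin m), ((w : ℝ) / h - 5 * w * γ) * m ≤ #S ∧
      ((w : ℝ) / h - 5 * w * γ) * m ≤ #T ∧ ∀ i ∈ S, ∀ j ∈ T, ¬ R i j
  · obtain ⟨S, T, hS, hT, hST⟩ := hne
    exact Or.inl <| extremalWith_of_reduced_empty_pair (η := 6 * w * γ) hX hY
      ((le_max_right _ _).trans hn) hh0 (by omega) (by omega) hAX hBY hcA hcB hdA hdB hmn hRA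
      hε₀0.le (by linarith) (by linarith) (by linarith) (by linarith) (by linarith) (by linarith)
      hS hT hST
  right
  push Not at hne
  have hdegA : ∀ i, ((u : ℝ) / h - 2 * γ) * m ≤ #{j | R i j} := by
    intro i
    refine le_trans (mul_le_mul_of_nonneg_right (by linarith) (by positivity))
      (card_reduced_neighbors_ge (δ := (u : ℝ) / h - γ) hℓ (hcA i) hBY hcB hdB hY hmn (hRA i)
        hε₀0.le (by linarith) (by linarith) (by linarith) fun x hx => (hdeg x).trans ?_)
    exact_mod_cast hG.degree_le_degIn (hAX i hx)
  have hdegB : ∀ j, ((u : ℝ) / h - 2 * γ) * m ≤ #{i | R i j} := by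
    intro j
    simp only [hR, dens_comm G _ (B j)]
    refine le_trans (mul_le_mul_of_nonneg_right (by linarith) (by positivity))
      (card_reduced_neighbors_ge (δ := (u : ℝ) / h - γ) hℓ (hcB j) hAX hcA hdA hX hmn (hRB j)
        hε₀0.le (by linarith) (by linarith) (by linarith) fun x hx => (hdeg x).trans ?_)
    exact_mod_cast hG.symm.degree_le_degIn (hBY j hx)
  obtain ⟨c, hcR, hc, hc'⟩ := exists_perfect_oriented_tiling R hp0 hpq rfl
    (hall_of_degree_of_no_large_empty_pair R hu hw0 hh hz0 hpq.le (Fintype.card_fin m)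
      (Fintype.card_fin m) hγ
      (fun i => by convert hdegA i) (fun j => by convert hdegB j) hne)
    (hall_of_degree_of_no_large_empty_pair (fun j i => R i j) hu hw0 hh hz0 hpq.le
      (Fintype.card_fin m) (Fintype.card_fin m) hγ (fun j => by convert hdegB j)
      (fun i => by convert hdegA i) fun S T hS hT => by
        obtain ⟨i, hi, j, hj, hij⟩ := hne T S hT hS
        exact ⟨j, hj, i, hi, hij⟩)
  have hLR : 2 / (γ / 16) ≤ L := (Nat.le_ceil _).trans (by exact_mod_cast (by omega))
  exact hasAlmostCover_of_reduced_tiling (τ := γ / 16) (d₀ := γ / 2) hG hX hY hp0 (hp0.trans hpq)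
    hAX hBY hcA hcB hdA hdB hmn (fun i j h => hU i j h.1) (fun i j h => h.2) hcR hc hc' hε₀0.le
    (by linarith) (by linarith) (by linarith) (by linarith) (by linarith) (by linarith)
    (by linarith) (by linarith) (by linarith) hLR (by omega)

end BipTiling
end

section
/- Let G[X,Y] be a bipartite graph with minimum degree δ and |X| ≤ |Y|. Then G has a matching of size at least min{2δ, |X|}. -/
open Finset

attribute [local instance] Classical.propDecidable

namespace BipTiling

variable {α β V : Type*}

/-- **Hall's marriage theorem, deficiency version**: if every set `s` of indices satisfies
`#s ≤ #(s.biUnion t) + d`, then all but at most `d` of the sets `t i` have distinct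
representatives, recorded as a finset of pairs `(i, a)` with `a ∈ t i`. -/
theorem exists_partial_matching_of_card_le_biUnion_add {ι α : Type*} [Fintype ι] [Fintype α]
    (t : ι → Finset α) (d : ℕ) (h : ∀ s : Finset ι, #s ≤ #(s.biUnion t) + d) :
    ∃ M : Finset (ι × α), Fintype.card ι ≤ #M + d ∧ (∀ p ∈ M, p.2 ∈ t p.1) ∧
      Set.InjOn Prod.fst (M : Set (ι × α)) ∧ Set.InjOn Prod.snd (M : Set (ι × α)) := by
  obtain ⟨g, hg, hgt⟩ := (Finset.all_card_le_biUnion_card_iff_exists_injective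
    (fun i => (t i).disjSum (univ : Finset (Fin d)))).1 fun s => by
      rcases s.eq_empty_or_nonempty with rfl | ⟨i, hi⟩
      · simp
      have hsub : (s.biUnion t).disjSum (univ : Finset (Fin d)) ⊆
          s.biUnion fun i => (t i).disjSum univ := by
        rintro (a | a) ha
        · simpa using ha
        · simpa using ⟨i, hi⟩
      calc #s ≤ #(s.biUnion t) + d := h s
        _ = #((s.biUnion t).disjSum (univ : Finset (Fin d))) := by simp
        _ ≤ _ := card_le_card hsub
  refine ⟨univ.filter fun p => g p.1 = Sum.inl p.2, ?_, ?_, ?_, ?_⟩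
  · set M : Finset (ι × α) := univ.filter fun p => g p.1 = Sum.inl p.2 with hM
    have hsub : univ.image g ⊆ (M.image Prod.snd).disjSum (univ : Finset (Fin d)) := by
      intro b hb
      obtain ⟨i, -, rfl⟩ := mem_image.1 hb
      rcases hi : g i with a | a
      · simpa [hM] using ⟨i, hi⟩
      · simp
    have hcard := card_le_card hsub
    rw [card_image_of_injective _ hg, card_univ, card_disjSum, card_univ, Fintype.card_fin] at hcard
    exact hcard.trans (Nat.add_le_add_right card_image_le d)
  · rintro ⟨i, a⟩ hp
    have hi := hgt i
    rw [(mem_filter.1 hp).2] at hi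
    simpa using hi
  · rintro ⟨i, a⟩ hp ⟨j, b⟩ hq (rfl : i = j)
    simp only [coe_filter, mem_univ, true_and, Set.mem_ofPred_eq] at hp hq
    simpa [hp] using hq
  · rintro ⟨i, a⟩ hp ⟨j, b⟩ hq (rfl : a = b)
    simp only [coe_filter, mem_univ, true_and, Set.mem_ofPred_eq] at hp hq
    rw [hg (hp.trans hq.symm)]

theorem BipartiteWith.mem_right {V : Type*} [Fintype V] {G : SimpleGraph V} {X Y : Finset V}
    (hbip : BipartiteWith G X Y) {x y : V} (hx : x ∈ X) (h : G.Adj x y) : y ∈ Y := by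
  rcases hbip.cross h with h' | h'
  · exact h'.2
  · exact absurd h'.1 (disjoint_left.1 hbip.disj hx)

theorem BipartiteWith.mem_left {V : Type*} [Fintype V] {G : SimpleGraph V} {X Y : Finset V}
    (hbip : BipartiteWith G X Y) {x y : V} (hy : y ∈ Y) (h : G.Adj x y) : x ∈ X := by
  rcases hbip.cross h with h' | h'
  · exact h'.1
  · exact absurd hy (disjoint_left.1 hbip.disj h'.2)

theorem BipartiteWith.card_le_card_biUnion_neighborFinset_add {V : Type*} [Fintype V]
    {G : SimpleGraph V} {X Y : Finset V} (hbip : BipartiteWith G X Y) (hXY : #X ≤ #Y)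
    {δ : ℕ} (hδ : ∀ v : V, δ ≤ G.degree v) {S : Finset V} (hS : S ⊆ X) :
    #S ≤ #(S.biUnion fun x => G.neighborFinset x) + (#X - 2 * δ) := by
  rcases S.eq_empty_or_nonempty with rfl | ⟨x, hx⟩
  · simp
  by_cases hY : Y ⊆ S.biUnion fun x => G.neighborFinset x
  · exact ((card_le_card hS).trans (hXY.trans (card_le_card hY))).trans (Nat.le_add_right _ _)
  obtain ⟨y, hy, hyS⟩ := not_subset.1 hY
  have hN : δ ≤ #(S.biUnion fun x => G.neighborFinset x) :=
    (hδ x).trans (card_le_card (subset_biUnion_of_mem (fun x => G.neighborFinset x) hx))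
  have hsub : G.neighborFinset y ⊆ X \ S := by
    intro z hz
    rw [SimpleGraph.mem_neighborFinset] at hz
    refine mem_sdiff.2 ⟨hbip.mem_left hy hz.symm, fun hzS => hyS ?_⟩
    exact mem_biUnion.2 ⟨z, hzS, by simpa using hz.symm⟩
  have hle := (hδ y).trans (card_le_card hsub)
  rw [card_sdiff_of_subset hS] at hle
  have := card_le_card hS
  omega

/-- Fact 4.7. If `G[X,Y]` is a bipartite graph with minimum degree `δ` and
`|X| ≤ |Y|`, then `G` has a matching of size at least `min {2δ, |X|}`. -/
theorem statement_13 {V : Type*} [Fintype V] (G : SimpleGraph V) (X Y : Finset V)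
    (hbip : BipartiteWith G X Y) (hXY : X.card ≤ Y.card)
    (δ : ℕ) (hδ : ∀ v : V, δ ≤ G.degree v) :
    ∃ M : Finset (V × V), min (2 * δ) X.card ≤ M.card ∧
      (∀ e ∈ M, G.Adj e.1 e.2) ∧
      (∀ e ∈ M, ∀ e' ∈ M, e ≠ e' →
        e.1 ≠ e'.1 ∧ e.1 ≠ e'.2 ∧ e.2 ≠ e'.1 ∧ e.2 ≠ e'.2) := by
  obtain ⟨M, hcard, hM, hfst, hsnd⟩ := exists_partial_matching_of_card_le_biUnion_add
    (fun x : X => G.neighborFinset x) (#X - 2 * δ) fun s => by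
      have h := hbip.card_le_card_biUnion_neighborFinset_add hXY hδ
        (S := s.map (Function.Embedding.subtype _)) fun x hx => by
          obtain ⟨z, -, rfl⟩ := mem_map.1 hx
          exact z.2
      rw [card_map, map_eq_image, image_biUnion] at h
      exact h
  have hadj : ∀ p ∈ M, G.Adj p.1 p.2 := fun p hp => by simpa using hM p hp
  have hne : ∀ p ∈ M, ∀ q ∈ M, (p.1 : V) ≠ q.2 := fun p _ q hq h =>
    disjoint_left.1 hbip.disj p.1.2 (h ▸ hbip.mem_right q.1.2 (hadj q hq))
  refine ⟨M.map ⟨fun p => (p.1, p.2), fun p q h => ?_⟩, ?_, ?_, ?_⟩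
  · simp only [Prod.mk.injEq] at h
    exact Prod.ext (Subtype.ext h.1) h.2
  · rw [Fintype.card_coe] at hcard
    rw [card_map]
    omega
  · intro e he
    obtain ⟨p, hp, rfl⟩ := mem_map.1 he
    exact hadj p hp
  · intro e he e' he' hee
    obtain ⟨p, hp, rfl⟩ := mem_map.1 he
    obtain ⟨q, hq, rfl⟩ := mem_map.1 he'
    have hpq : p ≠ q := fun h => hee (h ▸ rfl)
    exact ⟨fun h => hpq (hfst hp hq (Subtype.ext h)), hne p hp q hq, (hne q hq p hp).symm,
      fun h => hpq (hsnd hp hq h)⟩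

end BipTiling
end
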